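/- arXiv:2102.03760 — 10 statements merged into one kernel-verified Lean document; each statement's English description precedes it below -/
import Mathlib

section
/- Let N be the N-matrix of a mixed graph on vertex set V = V₁ ⊔ V₂ (disjoint union), and suppose there are vertices u ∈ V₁ and v ∈ V₂ such that N_{uv} ≠ 0 and N_{xy} = 0 for every other pair x ∈ V₁, y ∈ V₂ with (x,y) ≠ (u,v) (i.e., uv is a cut edge joining the two parts). Let N₁ and N₂ denote the principal submatrices of N indexed by V₁ and V₂, respectively. Then the characteristic polynomial satisfies charpoly(N) = charpoly(N₁)·charpoly(N₂) − charpoly(N₁ with row and column u deleted)·charpoly(N₂ with row and column v deleted). -/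
open Matrix Complex

/-- The sixth root of unity `ω = (1 + i√3)/2`. -/
noncomputable def ω6 : ℂ := (1 + Complex.I * Real.sqrt 3) / 2

lemma det_updateRow_single_self_aux {n R : Type*} [Fintype n] [DecidableEq n] [CommRing R]
    (A : Matrix n n R) (u : n) :
    (A.updateRow u (Pi.single u 1)).det =
      (A.submatrix (fun x : {x : n // x ≠ u} => (x : n)) (fun x : {x : n // x ≠ u} => (x : n))).det := by
  rw [Matrix.twoBlockTriangular_det _ (fun x => x ≠ u)]
  · have h1 : (toSquareBlockProp (A.updateRow u (Pi.single u 1)) (fun x => ¬ (x ≠ u))) = 1 := by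
      ext ⟨i, hi⟩ ⟨j, hj⟩
      have hi : i = u := not_not.mp hi
      have hj : j = u := not_not.mp hj
      subst hi
      subst hj
      simp [toSquareBlockProp]
    rw [h1, det_one, mul_one]
    congr 1
    ext ⟨i, hi⟩ ⟨j, hj⟩
    simp [toSquareBlockProp, hi]
  · intro i hi j hj
    have hi : i = u := not_not.mp hi
    subst hi
    simp [hj]

lemma det_fromBlocks_cut_aux {m n R : Type*} [Fintype m] [DecidableEq m] [Fintype n]
    [DecidableEq n] [CommRing R] (A : Matrix m m R) (D : Matrix n n R) (u : m) (v : n) (c d : R) :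
    (fromBlocks A (Matrix.single u v c) (Matrix.single v u d) D).det =
      A.det * D.det - c * d * ((A.updateRow u (Pi.single u 1)).det *
        (D.updateRow v (Pi.single v 1)).det) := by
  set M := fromBlocks A (Matrix.single u v c) (Matrix.single v u d) D with hM
  have e1 : M = M.updateRow (Sum.inl u)
      (Sum.elim (A u) 0 + c • Pi.single (Sum.inr v) (1 : R)) := by
    ext i j
    by_cases hi : i = Sum.inl u
    · subst hi
      rcases j with j | j
      · simp [hM]
      · simp [hM, Matrix.single_apply, Pi.single_apply, eq_comm]
    · simp [hi]
  have e2 : M.updateRow (Sum.inl u) (Sum.elim (A u) 0) =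
      fromBlocks A 0 (Matrix.single v u d) D := by
    ext i j
    by_cases hi : i = Sum.inl u
    · subst hi
      rcases j with j | j <;> simp
    · rw [updateRow_ne hi]
      rcases i with i | i <;> rcases j with j | j <;> simp [hM, Matrix.single_apply]
      intro h
      exact absurd (congrArg Sum.inl h.symm) hi
  set M2 := M.updateRow (Sum.inl u) (Pi.single (Sum.inr v) (1 : R)) with hM2
  have e3 : M2 = M2.updateRow (Sum.inr v)
      (Sum.elim (0 : m → R) (D v) + d • Pi.single (Sum.inl u) (1 : R)) := by
    ext i j
    by_cases hi : i = Sum.inr v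
    · subst hi
      rcases j with j | j
      · simp [hM2, hM, Matrix.single_apply, Pi.single_apply, eq_comm]
      · simp [hM2, hM]
    · simp [hi]
  have e4 : M2.updateRow (Sum.inr v) (Sum.elim (0 : m → R) (D v)) =
      fromBlocks (A.updateRow u 0) (Matrix.single u v 1) 0 D := by
    ext i j
    rcases i with i | i
    · by_cases hi : i = u
      · subst hi
        rcases j with j | j
        · simp [hM2]
        · simp [hM2, Matrix.single_apply, Pi.single_apply, eq_comm]
      · rcases j with j | j <;> simp [hM2, hM, hi, Matrix.single_apply, Ne.symm hi]
    · by_cases hi : i = v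
      · subst hi
        rcases j with j | j <;> simp
      · rcases j with j | j <;> simp [hM2, hM, hi, Matrix.single_apply, Ne.symm hi]
  have e5 : (M2.updateRow (Sum.inr v) (Pi.single (Sum.inl u) (1 : R))).submatrix
        (Equiv.swap (Sum.inl u) (Sum.inr v)) id =
      fromBlocks (A.updateRow u (Pi.single u 1)) 0 0 (D.updateRow v (Pi.single v 1)) := by
    ext i j
    rcases i with i | i
    · by_cases hi : i = u
      · subst hi
        rcases j with j | j <;> simp [Pi.single_apply]
      · rw [submatrix_apply, Equiv.swap_apply_of_ne_of_ne (by simpa using hi) (by simp)]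
        rcases j with j | j <;> simp [hM2, hM, hi, Matrix.single_apply, Ne.symm hi]
    · by_cases hi : i = v
      · subst hi
        rcases j with j | j <;> simp [hM2, Pi.single_apply]
      · rw [submatrix_apply, Equiv.swap_apply_of_ne_of_ne (by simp) (by simpa using hi)]
        rcases j with j | j <;> simp [hM2, hM, hi, Matrix.single_apply, Ne.symm hi]
  have e6 := congrArg det e5
  rw [det_permute, Equiv.Perm.sign_swap (by simp), det_fromBlocks_zero₂₁] at e6
  have e7 : (A.updateRow u 0).det = 0 := det_eq_zero_of_row_eq_zero u (by simp)
  have e8 : M2.det = d * (M2.updateRow (Sum.inr v) (Pi.single (Sum.inl u) (1 : R))).det := by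
    conv_lhs => rw [e3]
    rw [det_updateRow_add, det_updateRow_smul, e4, det_fromBlocks_zero₂₁, e7]
    ring
  conv_lhs => rw [e1]
  rw [det_updateRow_add, det_updateRow_smul, e2, det_fromBlocks_zero₁₂, ← hM2, e8, ← e6]
  push_cast
  ring

/-- If `uv` is a cut edge of a mixed graph joining the two parts `V₁` and `V₂`
of the vertex set, then the characteristic polynomial of the N-matrix factors as
`charpoly N = charpoly N₁ · charpoly N₂ − charpoly (N₁ − u) · charpoly (N₂ − v)`. -/
theorem charpoly_cut_edge
    {V₁ V₂ : Type*} [Fintype V₁] [Fintype V₂] [DecidableEq V₁] [DecidableEq V₂]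
    (N : Matrix (V₁ ⊕ V₂) (V₁ ⊕ V₂) ℂ)
    (hherm : N.IsHermitian) (hdiag : ∀ u, N u u = 0)
    (hent : ∀ u v, N u v ∈ ({0, 1, ω6, star ω6} : Set ℂ))
    (u : V₁) (v : V₂)
    (huv : N (Sum.inl u) (Sum.inr v) ≠ 0)
    (hcut : ∀ x : V₁, ∀ y : V₂, (x, y) ≠ (u, v) → N (Sum.inl x) (Sum.inr y) = 0) :
    N.charpoly =
      (N.submatrix Sum.inl Sum.inl).charpoly * (N.submatrix Sum.inr Sum.inr).charpoly
      - (N.submatrix (fun x : {x : V₁ // x ≠ u} => Sum.inl (x : V₁))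
            (fun x : {x : V₁ // x ≠ u} => Sum.inl (x : V₁))).charpoly
        * (N.submatrix (fun y : {y : V₂ // y ≠ v} => Sum.inr (y : V₂))
            (fun y : {y : V₂ // y ≠ v} => Sum.inr (y : V₂))).charpoly := by
  have hω : ω6 * star ω6 = 1 := by
    have h3 : ((Real.sqrt 3 : ℝ) : ℂ) ^ 2 = 3 := by
      rw [← Complex.ofReal_pow, Real.sq_sqrt (by norm_num)]
      norm_num
    simp only [ω6, Complex.star_def, map_div₀, map_add, map_mul, map_one, Complex.conj_I,
      Complex.conj_ofReal, map_ofNat]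
    linear_combination (-(Complex.I ^ 2) / 4) * h3 - (3 / 4 : ℂ) * Complex.I_sq
  have hsym : N (Sum.inr v) (Sum.inl u) = star (N (Sum.inl u) (Sum.inr v)) :=
    (hherm.apply _ _).symm
  have hcd : N (Sum.inl u) (Sum.inr v) * N (Sum.inr v) (Sum.inl u) = 1 := by
    rw [hsym]
    have h := hent (Sum.inl u) (Sum.inr v)
    simp only [Set.mem_insert_iff, Set.mem_singleton_iff] at h
    rcases h with h | h | h | h
    · exact absurd h huv
    · simp [h]
    · rw [h, hω]
    · rw [h, star_star, mul_comm, hω]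
  have hcut' : ∀ x : V₁, ∀ y : V₂, (x, y) ≠ (u, v) → N (Sum.inr y) (Sum.inl x) = 0 := by
    intro x y h
    rw [← hherm.apply, hcut x y h, star_zero]
  have hblock : N.charmatrix = fromBlocks (N.submatrix Sum.inl Sum.inl).charmatrix
      (Matrix.single u v (-Polynomial.C (N (Sum.inl u) (Sum.inr v))))
      (Matrix.single v u (-Polynomial.C (N (Sum.inr v) (Sum.inl u))))
      (N.submatrix Sum.inr Sum.inr).charmatrix := by
    ext1 i j
    rcases i with i | i <;> rcases j with j | j
    · simp [charmatrix_apply, diagonal_apply]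
    · by_cases h : (i, j) = (u, v)
      · obtain ⟨rfl, rfl⟩ := Prod.mk.inj h
        simp [charmatrix_apply]
      · have h' : ¬ (u = i ∧ v = j) := fun h' => h (by rw [h'.1, h'.2])
        simp [charmatrix_apply, Matrix.single_apply, h', hcut i j h]
    · by_cases h : (j, i) = (u, v)
      · obtain ⟨rfl, rfl⟩ := Prod.mk.inj h
        simp [charmatrix_apply]
      · have h' : ¬ (v = i ∧ u = j) := fun h' => h (by rw [h'.1, h'.2])
        simp [charmatrix_apply, Matrix.single_apply, h', hcut' j i h]
    · simp [charmatrix_apply, diagonal_apply]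
  have hA : (N.submatrix (fun x : {x : V₁ // x ≠ u} => Sum.inl (x : V₁))
      (fun x : {x : V₁ // x ≠ u} => Sum.inl (x : V₁))).charmatrix =
      (N.submatrix Sum.inl Sum.inl).charmatrix.submatrix
        (fun x : {x : V₁ // x ≠ u} => (x : V₁)) (fun x : {x : V₁ // x ≠ u} => (x : V₁)) := by
    ext1 i j
    simp [charmatrix_apply, diagonal_apply, Subtype.ext_iff]
  have hD : (N.submatrix (fun x : {x : V₂ // x ≠ v} => Sum.inr (x : V₂))
      (fun x : {x : V₂ // x ≠ v} => Sum.inr (x : V₂))).charmatrix =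
      (N.submatrix Sum.inr Sum.inr).charmatrix.submatrix
        (fun x : {x : V₂ // x ≠ v} => (x : V₂)) (fun x : {x : V₂ // x ≠ v} => (x : V₂)) := by
    ext1 i j
    simp [charmatrix_apply, diagonal_apply, Subtype.ext_iff]
  simp only [Matrix.charpoly]
  rw [hblock, det_fromBlocks_cut_aux, hA, hD, det_updateRow_single_self_aux,
    det_updateRow_single_self_aux, neg_mul_neg, ← Polynomial.C_mul, hcd, Polynomial.C_1, one_mul]
end

section
/- Let N be the N-matrix of a mixed graph whose underlying graph G is connected, and let Δ be the maximum degree of G. Then the spectral radius of N equals Δ if and only if G is Δ-regular (every vertex has degree Δ) and there exists a function f : V → T₆ (the sixth roots of unity) such that either N_{uv} = f(u)·conj(f(v)) for every pair u, v with N_{uv} ≠ 0, or N_{uv} = −f(u)·conj(f(v)) for every pair u, v with N_{uv} ≠ 0. -/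
open Matrix Complex

/-- The group `T₆ = {1, -1, ω, ω̄, -ω, -ω̄}` of sixth roots of unity in `ℂ`. -/
noncomputable def T6 : Set ℂ := {1, -1, ω6, star ω6, -ω6, -star ω6}

lemma w6_add : ω6 + star ω6 = 1 := by
  apply Complex.ext <;> simp [ω6] <;> ring

lemma w6_mul : ω6 * star ω6 = 1 := by
  have h : (Real.sqrt 3) * (Real.sqrt 3) = 3 := Real.mul_self_sqrt (by norm_num)
  apply Complex.ext
  · simp [ω6]; nlinarith
  · simp [ω6]; ring

lemma mem_T6_iff (z : ℂ) : z ∈ T6 ↔ z ^ 6 = 1 := by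
  have ha := w6_add
  have hm := w6_mul
  generalize hw : star ω6 = w at ha hm
  have e : z ^ 6 - 1 = (z - 1) * (z + 1) * (z - ω6) * (z - w) * (z + ω6) * (z + w) := by
    have h1 : (z - ω6) * (z - w) = z ^ 2 - z + 1 := by linear_combination (-z) * ha + hm
    have h2 : (z + ω6) * (z + w) = z ^ 2 + z + 1 := by linear_combination z * ha + hm
    calc _ = (z - 1) * (z + 1) * (z ^ 2 - z + 1) * (z ^ 2 + z + 1) := by ring
      _ = _ := by rw [← h1, ← h2]; ring
  rw [← sub_eq_zero, e]
  simp only [T6, hw, Set.mem_insert_iff, Set.mem_singleton_iff, mul_eq_zero, sub_eq_zero,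
    add_eq_zero_iff_eq_neg]
  tauto

lemma norm_of_mem_T6 {z : ℂ} (h : z ∈ T6) : ‖z‖ = 1 := by
  rw [mem_T6_iff] at h
  have : ‖z‖ ^ 6 = 1 := by rw [← norm_pow, h, norm_one]
  exact (pow_eq_one_iff_of_nonneg (norm_nonneg z) (by norm_num)).1 this

lemma ent_T6 {z : ℂ} (h : z ∈ ({0, 1, ω6, star ω6} : Set ℂ)) (h0 : z ≠ 0) : z ∈ T6 := by
  simp only [T6, Set.mem_insert_iff, Set.mem_singleton_iff] at *
  tauto

lemma ncard_eq_sum {V : Type*} [Fintype V] [DecidableEq V] (N : Matrix V V ℂ)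
    (hent : ∀ u v, N u v ∈ ({0, 1, ω6, star ω6} : Set ℂ)) (u : V) :
    (({v | N u v ≠ 0}.ncard : ℕ) : ℝ) = ∑ v, ‖N u v‖ := by
  classical
  have : ∀ v, ‖N u v‖ = if N u v ≠ 0 then 1 else 0 := by
    intro v
    split_ifs with h
    · exact norm_of_mem_T6 (ent_T6 (hent u v) h)
    · simpa using h
  rw [Finset.sum_congr rfl (fun v _ => this v), Finset.sum_boole]
  rw [Set.ncard_eq_toFinset_card']
  simp

/-- The modulus of an eigenvalue is at most the maximum degree. -/
lemma eig_bound {V : Type*} [Fintype V] (N : Matrix V V ℂ)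
    (μ : ℝ) (x : V → ℂ) (u : V) (Δ : ℝ) (hd : ∑ v, ‖N u v‖ ≤ Δ)
    (hx : ∑ v, N u v * x v = μ * x u) (h0 : x u ≠ 0) (hmax : ∀ v, ‖x v‖ ≤ ‖x u‖) :
    |μ| ≤ Δ := by
  have hp : 0 < ‖x u‖ := norm_pos_iff.2 h0
  have h1 : |μ| * ‖x u‖ ≤ Δ * ‖x u‖ := by
    calc |μ| * ‖x u‖ = ‖∑ v, N u v * x v‖ := by rw [hx]; simp
      _ ≤ ∑ v, ‖N u v * x v‖ := norm_sum_le _ _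
      _ ≤ ∑ v, ‖N u v‖ * ‖x u‖ := Finset.sum_le_sum fun v _ => by
          rw [norm_mul]; exact mul_le_mul_of_nonneg_left (hmax v) (norm_nonneg _)
      _ = (∑ v, ‖N u v‖) * ‖x u‖ := by rw [Finset.sum_mul]
      _ ≤ _ := by gcongr
  exact le_of_mul_le_mul_right h1 hp

/-- Rigidity at a vertex of maximal modulus. -/
lemma rigid {V : Type*} [Fintype V] (N : Matrix V V ℂ)
    (s : ℂ) (hs : ‖s‖ = 1) (x : V → ℂ) (u : V) (Δ : ℝ) (hd : ∑ v, ‖N u v‖ ≤ Δ)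
    (hN : ∀ v, N u v ≠ 0 → ‖N u v‖ = 1)
    (hx : ∑ v, N u v * x v = s * Δ * x u) (h0 : x u ≠ 0) (hmax : ∀ v, ‖x v‖ ≤ ‖x u‖) :
    ∑ v, ‖N u v‖ = Δ ∧ ∀ v, N u v ≠ 0 → N u v * x v = s * x u := by
  have hp : 0 < ‖x u‖ := norm_pos_iff.2 h0
  set y := s * x u with hy
  have hny : ‖y‖ = ‖x u‖ := by rw [hy, norm_mul, hs, one_mul]
  have hle : ∀ v, (N u v * x v * star y).re ≤ ‖N u v‖ * ‖x u‖ ^ 2 := fun v => by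
    refine (Complex.re_le_norm _).trans ?_
    rw [norm_mul, norm_mul, norm_star, hny, mul_assoc]
    have := hmax v
    gcongr
    nlinarith
  have hsum : ∑ v, (N u v * x v * star y).re = Δ * ‖x u‖ ^ 2 := by
    rw [← Complex.re_sum, ← Finset.sum_mul, hx]
    have : s * Δ * x u * star y = ((Δ * ‖x u‖ ^ 2 : ℝ) : ℂ) := by
      have : y * star y = ((‖x u‖ ^ 2 : ℝ) : ℂ) := by
        rw [← hny]; have := Complex.mul_conj' y; push_cast; exact this
      push_cast at this ⊢
      rw [← this, hy]; ring
    rw [this, Complex.ofReal_re]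
  have hge : ∑ v, ‖N u v‖ * ‖x u‖ ^ 2 ≤ Δ * ‖x u‖ ^ 2 := by
    rw [← Finset.sum_mul]; gcongr
  have hge2 := Finset.sum_le_sum (fun v (_ : v ∈ Finset.univ) => hle v)
  have heq : ∑ v, (N u v * x v * star y).re = ∑ v, ‖N u v‖ * ‖x u‖ ^ 2 := by linarith
  refine ⟨?_, ?_⟩
  · rw [hsum, ← Finset.sum_mul] at heq
    exact (mul_right_cancel₀ (by positivity) heq).symm
  · intro v hv
    have h1 := (Finset.sum_eq_sum_iff_of_le (fun v _ => hle v)).1 heq v (Finset.mem_univ v)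
    rw [hN v hv, one_mul] at h1
    have h2 : ‖N u v * x v‖ ≤ ‖x u‖ := by rw [norm_mul, hN v hv, one_mul]; exact hmax v
    have h3 : Complex.normSq (N u v * x v - y) ≤ 0 := by
      rw [Complex.normSq_sub, Complex.normSq_eq_norm_sq, Complex.normSq_eq_norm_sq, hny]
      have : (N u v * x v * (starRingEnd ℂ) y).re = ‖x u‖ ^ 2 := h1
      rw [this]
      nlinarith [norm_nonneg (N u v * x v)]
    have h4 := Complex.normSq_eq_zero.1 (le_antisymm h3 (Complex.normSq_nonneg _))
    exact sub_eq_zero.1 h4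

/-- For a mixed graph with connected underlying graph `G` and maximum degree
`Δ`, the spectral radius of the N-matrix equals `Δ` iff `G` is `Δ`-regular and there is a
function `f : V → T₆` with `N_{uv} = f(u)·conj(f(v))` for all edges `uv`, or
`N_{uv} = −f(u)·conj(f(v))` for all edges `uv`. -/
theorem spectral_radius_eq_maxDegree_iff
    {V : Type*} [Fintype V] [DecidableEq V] [Nonempty V]
    (N : Matrix V V ℂ) (hherm : N.IsHermitian)
    (hdiag : ∀ u, N u u = 0)
    (hent : ∀ u v, N u v ∈ ({0, 1, ω6, star ω6} : Set ℂ))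
    (G : SimpleGraph V) (hadj : ∀ u v, G.Adj u v ↔ N u v ≠ 0)
    (hconn : G.Connected)
    (Δ : ℕ) (hΔ : IsGreatest (Set.range fun u => {v | N u v ≠ 0}.ncard) Δ) :
    IsGreatest (Set.range fun i => |hherm.eigenvalues i|) (Δ : ℝ) ↔
      ((∀ u, {v | N u v ≠ 0}.ncard = Δ) ∧
        ∃ f : V → ℂ, (∀ v, f v ∈ T6) ∧
          ((∀ u v, N u v ≠ 0 → N u v = f u * star (f v)) ∨
           (∀ u v, N u v ≠ 0 → N u v = -(f u * star (f v))))) := by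
  have hdeg : ∀ u, ∑ v, ‖N u v‖ ≤ (Δ : ℝ) := fun u => by
    rw [← ncard_eq_sum N hent u]
    exact_mod_cast hΔ.2 ⟨u, rfl⟩
  have hN : ∀ u v, N u v ≠ 0 → ‖N u v‖ = 1 := fun u v h => norm_of_mem_T6 (ent_T6 (hent u v) h)
  have heig : ∀ i, ∃ x : V → ℂ, (∀ u, ∑ v, N u v * x v = (hherm.eigenvalues i : ℂ) * x u) ∧
      ∃ u, x u ≠ 0 ∧ ∀ v, ‖x v‖ ≤ ‖x u‖ := by
    intro i
    refine ⟨⇑(hherm.eigenvectorBasis i), fun u => ?_, ?_⟩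
    · have := congrFun (hherm.mulVec_eigenvectorBasis i) u
      simpa [Matrix.mulVec, dotProduct] using this
    · obtain ⟨u, hu⟩ := Finite.exists_max (fun v => ‖hherm.eigenvectorBasis i v‖)
      refine ⟨u, fun h => ?_, hu⟩
      apply hherm.eigenvectorBasis.orthonormal.ne_zero i
      ext v
      have := hu v
      rw [h, norm_zero] at this
      simpa using this
  have hbound : ∀ i, |hherm.eigenvalues i| ≤ (Δ : ℝ) := fun i => by
    obtain ⟨x, hx, u, h0, hmax⟩ := heig i
    exact eig_bound N _ x u Δ (hdeg u) (hx u) h0 hmax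
  constructor
  · rintro ⟨⟨i, hi⟩, -⟩
    obtain ⟨x, hx, u0, h0, hmax⟩ := heig i
    obtain ⟨s, hs, hsμ⟩ : ∃ s : ℂ, (s = 1 ∨ s = -1) ∧ (hherm.eigenvalues i : ℂ) = s * (Δ : ℝ) := by
      rcases eq_or_eq_neg_of_abs_eq hi with h | h
      · exact ⟨1, Or.inl rfl, by rw [h]; simp⟩
      · exact ⟨-1, Or.inr rfl, by rw [h]; simp⟩
    have hs1 : ‖s‖ = 1 := by rcases hs with rfl | rfl <;> simp
    have hs6 : s ^ 6 = 1 := by rcases hs with rfl | rfl <;> norm_num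
    have hss : s * s = 1 := by rcases hs with rfl | rfl <;> norm_num
    have key : ∀ u, ‖x u‖ = ‖x u0‖ → ∑ v, ‖N u v‖ = (Δ : ℝ) ∧
        ∀ v, N u v ≠ 0 → N u v * x v = s * x u := fun u hu =>
      rigid N s hs1 x u Δ (hdeg u) (hN u) (by rw [hx u, hsμ])
        (by rw [← norm_ne_zero_iff, hu, norm_ne_zero_iff]; exact h0)
        (fun v => by rw [hu]; exact hmax v)
    have hall : ∀ v, ‖x v‖ = ‖x u0‖ ∧ (x v / x u0) ^ 6 = 1 := by
      intro v
      have hr := (SimpleGraph.reachable_iff_reflTransGen u0 v).1 (hconn.preconnected u0 v)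
      induction hr with
      | refl => exact ⟨rfl, by rw [div_self h0, one_pow]⟩
      | tail _ hab ih =>
        rename_i a b _
        have hne := (hadj _ _).1 hab
        have e := (key a ih.1).2 b hne
        have n6 := (mem_T6_iff _).1 (ent_T6 (hent a b) hne)
        constructor
        · have := congrArg norm e
          rw [norm_mul, norm_mul, hN _ _ hne, hs1, one_mul, one_mul] at this
          rw [this, ih.1]
        · have e6 : (x b) ^ 6 = (x a) ^ 6 := by
            have := congrArg (· ^ 6) e
            simpa [mul_pow, n6, hs6] using this
          rw [div_pow, e6, ← div_pow]; exact ih.2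
    refine ⟨fun u => ?_, fun v => x v / x u0, fun v => (mem_T6_iff _).2 (hall v).2, ?_⟩
    · have := (key u (hall u).1).1
      rw [← ncard_eq_sum N hent u] at this
      exact_mod_cast this
    · have hf : ∀ u v, N u v ≠ 0 → N u v = s * ((x u / x u0) * star (x v / x u0)) := by
        intro u v h
        have e := (key u (hall u).1).2 v h
        have h1 : (x v / x u0) * star (x v / x u0) = 1 := by
          have := Complex.mul_conj' (x v / x u0)
          rw [norm_div, (hall v).1, div_self (norm_ne_zero_iff.2 h0)] at this
          simpa using this
        calc N u v = N u v * ((x v / x u0) * star (x v / x u0)) := by rw [h1, mul_one]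
          _ = (N u v * x v) / x u0 * star (x v / x u0) := by ring
          _ = _ := by rw [e]; ring
      rcases hs with rfl | rfl
      · left; intro u v h; simpa only [one_mul] using hf u v h
      · right; intro u v h; simpa only [neg_mul, one_mul] using hf u v h
  · rintro ⟨hreg, f, hf, hor⟩
    obtain ⟨s, hs, hsf⟩ : ∃ s : ℝ, |s| = 1 ∧ ∀ u v, N u v ≠ 0 → N u v = s * (f u * star (f v)) := by
      rcases hor with h | h
      · exact ⟨1, by simp, fun u v hn => by rw [h u v hn]; simp⟩
      · exact ⟨-1, by simp, fun u v hn => by rw [h u v hn]; simp⟩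
    have hev : N *ᵥ f = ((s * Δ : ℝ) : ℂ) • f := by
      ext u
      have h1 : ∀ v, N u v * f v = (‖N u v‖ : ℂ) * (s * f u) := by
        intro v
        by_cases h : N u v = 0
        · simp [h]
        · rw [hN u v h]
          have h1 : star (f v) * f v = 1 := by
            have := Complex.conj_mul' (f v)
            rw [norm_of_mem_T6 (hf v)] at this
            simpa using this
          rw [hsf u v h]
          push_cast
          linear_combination (s * f u) * h1
      have h2 := ncard_eq_sum N hent u
      rw [hreg u] at h2
      simp only [Matrix.mulVec, dotProduct, Pi.smul_apply, smul_eq_mul]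
      rw [Finset.sum_congr rfl (fun v _ => h1 v), ← Finset.sum_mul, ← Complex.ofReal_sum, ← h2]
      push_cast; ring
    have hf0 : f ≠ 0 := by
      intro h
      obtain ⟨v⟩ := ‹Nonempty V›
      have := norm_of_mem_T6 (hf v)
      rw [h] at this
      simp at this
    have hmem : ((s * Δ : ℝ) : ℂ) ∈ spectrum ℂ N := by
      rw [← Matrix.spectrum_toLin']
      apply Module.End.HasEigenvalue.mem_spectrum
      apply Module.End.hasEigenvalue_of_hasEigenvector (x := f)
      rw [Module.End.hasEigenvector_iff]
      exact ⟨Module.End.mem_eigenspace_iff.2 (by rw [Matrix.toLin'_apply]; exact hev), hf0⟩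
    have hmem' : (s * Δ : ℝ) ∈ spectrum ℝ N := spectrum.of_algebraMap_mem ℂ hmem
    rw [hherm.spectrum_real_eq_range_eigenvalues] at hmem'
    obtain ⟨i, hi⟩ := hmem'
    refine ⟨⟨i, ?_⟩, ?_⟩
    · simp only [hi, abs_mul, hs, one_mul, Nat.abs_cast]
    · rintro _ ⟨j, rfl⟩
      exact hbound j
end

section
/- Let N be the N-matrix of a mixed graph on vertex set V, let W ⊆ V be nonempty and U = V ∖ W, and suppose there is no arc from a vertex of U to a vertex of W, i.e., N_{uw} ≠ ω for all u ∈ U, w ∈ W. Let D be the diagonal matrix with D_{vv} = 1 for v ∈ W and D_{vv} = ω̄ for v ∈ U. Then N' = D*ND (where D* is the conjugate transpose of D, so D* = D⁻¹) is again an N-matrix of a mixed graph (all entries of N' lie in {0, 1, ω, ω̄}, N' is Hermitian with zero diagonal), and N' has the same characteristic polynomial (hence the same eigenvalues with multiplicity) as N. -/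
open Matrix Complex

/-- The diagonal matrix of a two-way switching with respect to a vertex subset `W`:
entries are `1` on `W` and `ω̄` off `W`. -/
noncomputable def switchD {V : Type*} [DecidableEq V] (W : Set V) [DecidablePred (· ∈ W)] :
    Matrix V V ℂ :=
  Matrix.diagonal (fun v => if v ∈ W then 1 else star ω6)

theorem star_omega_mul_self : star ω6 * ω6 = 1 := by
  have h3 : ((Real.sqrt 3 : ℝ) : ℂ) ^ 2 = 3 := by
    rw [← Complex.ofReal_pow, Real.sq_sqrt (by norm_num)]
    norm_num
  have hs : star ω6 = (1 - Complex.I * Real.sqrt 3) / 2 := by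
    simp [ω6, sub_eq_add_neg]
  rw [hs, ω6]
  linear_combination (-(Complex.I ^ 2) / 4) * h3 - 3 / 4 * Complex.I_sq

/-- (Two-way switching.) Suppose `W ⊆ V` is nonempty, `U = V \ W`, and there
is no arc from `U` to `W` (i.e. `N_{uw} ≠ ω` for `u ∈ U`, `w ∈ W`).  With `D` the diagonal
matrix which is `1` on `W` and `ω̄` on `U`, the matrix `N' = D*ND` is again the N-matrix of a
mixed graph and has the same characteristic polynomial as `N`. -/
theorem two_way_switching
    {V : Type*} [Fintype V] [DecidableEq V]
    (N : Matrix V V ℂ) (hherm : N.IsHermitian)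
    (hdiag : ∀ u, N u u = 0)
    (hent : ∀ u v, N u v ∈ ({0, 1, ω6, star ω6} : Set ℂ))
    (W : Set V) [DecidablePred (· ∈ W)] (hW : W.Nonempty)
    (harc : ∀ u ∉ W, ∀ w ∈ W, N u w ≠ ω6) :
    (∀ u v, ((switchD W)ᴴ * N * switchD W) u v ∈ ({0, 1, ω6, star ω6} : Set ℂ)) ∧
    ((switchD W)ᴴ * N * switchD W).IsHermitian ∧
    (∀ u, ((switchD W)ᴴ * N * switchD W) u u = 0) ∧
    ((switchD W)ᴴ * N * switchD W).charpoly = N.charpoly := by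
  have h1 := star_omega_mul_self
  have h2 : ω6 * star ω6 = 1 := by rw [mul_comm]; exact h1
  have hD : switchD W * (switchD W)ᴴ = 1 := by
    rw [switchD, Matrix.diagonal_conjTranspose, Matrix.diagonal_mul_diagonal,
      ← Matrix.diagonal_one]
    congr 1
    funext v
    by_cases hv : v ∈ W
    · simp [hv]
    · simp only [hv, if_false, Pi.star_apply, star_star]
      exact h1
  have he : ∀ u v, ((switchD W)ᴴ * N * switchD W) u v =
      star (if u ∈ W then 1 else star ω6) * N u v * (if v ∈ W then 1 else star ω6) := by
    intro u v
    rw [switchD, Matrix.diagonal_conjTranspose, Matrix.mul_diagonal, Matrix.diagonal_mul]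
    rfl
  refine ⟨?_, ?_, ?_, ?_⟩
  · intro u v
    rw [he]
    have huv := hent u v
    by_cases hu : u ∈ W <;> by_cases hv : v ∈ W
    · simpa [hu, hv] using huv
    · have hne : N u v ≠ star ω6 := by
        intro h
        apply harc v hv u hu
        rw [← hherm.apply v u, h, star_star]
      simp only [hu, hv, if_true, if_false, star_one, one_mul]
      rcases huv with h | h | h | h
      · simp [h]
      · simp [h]
      · rw [h, h2]; simp
      · exact absurd h hne
    · have hne := harc u hu v hv
      simp only [hu, hv, if_true, if_false, star_star, mul_one]
      rcases huv with h | h | h | h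
      · simp [h]
      · simp [h]
      · exact absurd h hne
      · rw [h, h2]; simp
    · simp only [hu, hv, if_false, star_star]
      have : ω6 * N u v * star ω6 = N u v := by linear_combination N u v * h2
      rw [this]
      exact huv
  · exact Matrix.isHermitian_conjTranspose_mul_mul _ hherm
  · intro u
    rw [he, hdiag]
    simp
  · rw [Matrix.mul_assoc, Matrix.charpoly_mul_comm, Matrix.mul_assoc, hD, Matrix.mul_one]
end

section
/- Let N be the N-matrix of a mixed graph on n vertices whose underlying graph T is a tree (a connected acyclic simple graph). Then the dimension of the kernel of N equals n − 2μ(T), where μ(T) is the matching number of T (the maximum cardinality of a set of pairwise vertex-disjoint edges of T). -/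
open Matrix Complex

/-- Existence of a leaf in a finite acyclic graph with an edge. -/
lemma exists_leaf_aux {V : Type*} [Fintype V] (G : SimpleGraph V) (h : G.IsAcyclic)
    (hne : ∃ a b, G.Adj a b) : ∃ u v, G.Adj v u ∧ ∀ w, G.Adj v w → w = u := by
  classical
  obtain ⟨a, b, hab⟩ := hne
  have : Nonempty V := ⟨a⟩
  have ⟨u, v, p, hp, hmax⟩ := SimpleGraph.Walk.exists_isPath_forall_isPath_length_le_length G
  have h1 := hmax _ _ _ (SimpleGraph.Path.singleton hab).2
  have hnil : ¬p.Nil := by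
    intro hn
    have := SimpleGraph.Walk.nil_iff_length_eq.mp hn
    simp [SimpleGraph.Path.singleton] at h1
    omega
  refine ⟨_, u, p.adj_snd hnil, fun w hadj ↦ ?_⟩
  apply h.eq_snd_of_adj_start hp hadj
  by_contra hw
  have := hmax _ _ _ (hp.cons (h := hadj.symm) hw)
  simp at this

/-- An involution encoding a matching of `G`. -/
def IsMatchInv {V : Type*} (G : SimpleGraph V) (f : V → V) : Prop :=
  (∀ x, f (f x) = x) ∧ ∀ x, f x ≠ x → G.Adj x (f x)

/-- The graph `G` with all edges at `u` or `v` removed. -/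
def delPair {V : Type*} (G : SimpleGraph V) (u v : V) : SimpleGraph V where
  Adj x y := G.Adj x y ∧ x ≠ u ∧ x ≠ v ∧ y ≠ u ∧ y ≠ v
  symm := ⟨fun _ _ h => ⟨h.1.symm, h.2.2.2.1, h.2.2.2.2, h.2.1, h.2.2.1⟩⟩
  loopless := ⟨fun _ h => G.loopless.irrefl _ h.1⟩

/-- The matrix `N` with rows and columns `u`, `v` zeroed. -/
def delMat {V : Type*} [DecidableEq V] (N : Matrix V V ℂ) (u v : V) : Matrix V V ℂ :=
  fun x y => if x = u ∨ x = v ∨ y = u ∨ y = v then 0 else N x y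

lemma delMat_mulVec {V : Type*} [Fintype V] [DecidableEq V] (N : Matrix V V ℂ) (u v : V)
    (huv : u ≠ v) (x : V → ℂ) (w : V) (hu : w ≠ u) (hv : w ≠ v) :
    (delMat N u v).mulVec x w = N.mulVec x w - N w u * x u - N w v * x v := by
  have h : ∀ z, delMat N u v w z * x z
      = N w z * x z - (if z = u then N w u * x u else 0) - (if z = v then N w v * x v else 0) := by
    intro z
    unfold delMat
    by_cases h1 : z = u
    · subst h1; simp [huv]
    · by_cases h2 : z = v
      · subst h2; simp [h1]
      · simp [h1, h2, hu, hv]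
  simp only [Matrix.mulVec, dotProduct, h, Finset.sum_sub_distrib]
  simp

lemma delMat_mulVec_pair {V : Type*} [Fintype V] [DecidableEq V] (N : Matrix V V ℂ) (u v : V)
    (x : V → ℂ) (w : V) (hw : w = u ∨ w = v) :
    (delMat N u v).mulVec x w = 0 := by
  simp only [Matrix.mulVec, dotProduct]
  apply Finset.sum_eq_zero
  intro z _
  unfold delMat
  rw [if_pos (by tauto)]
  simp

lemma finrank_ker_delMat {V : Type*} [Fintype V] [DecidableEq V] (N : Matrix V V ℂ) (u v : V)
    (huv : u ≠ v) (huu : N u u = 0) (hNuv : N u v ≠ 0) (hNvu : N v u ≠ 0)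
    (hv : ∀ w, w ≠ u → N v w = 0) (hv' : ∀ w, w ≠ u → N w v = 0) :
    Module.finrank ℂ (LinearMap.ker (delMat N u v).mulVecLin)
      = Module.finrank ℂ (LinearMap.ker N.mulVecLin) + 2 := by
  let K' := LinearMap.ker (delMat N u v).mulVecLin
  let L : (V → ℂ) →ₗ[ℂ] ℂ × ℂ :=
    (LinearMap.proj u).prod ((LinearMap.proj u).comp N.mulVecLin)
  have hL : ∀ x, L x = (x u, N.mulVec x u) := fun x => rfl
  let φ : K' →ₗ[ℂ] ℂ × ℂ := L.domRestrict K'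
  have hrow : ∀ x : V → ℂ, N.mulVec x v = N v u * x u := by
    intro x
    simp only [Matrix.mulVec, dotProduct]
    apply Finset.sum_eq_single u
    · intro b _ hb; simp [hv b hb]
    · simp
  have hmem : ∀ x : V → ℂ, x ∈ K' ↔ ∀ w, w ≠ u → w ≠ v → N.mulVec x w - N w u * x u = 0 := by
    intro x
    simp only [K', LinearMap.mem_ker, Matrix.mulVecLin_apply]
    constructor
    · intro h w h1 h2
      have := congrFun h w
      rw [delMat_mulVec N u v huv x w h1 h2, hv' w h1] at this
      simpa using this
    · intro h
      funext w
      by_cases hw : w = u ∨ w = v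
      · exact delMat_mulVec_pair N u v x w hw
      · push Not at hw
        rw [delMat_mulVec N u v huv x w hw.1 hw.2, hv' w hw.1]
        simpa using h w hw.1 hw.2
  have hle : LinearMap.ker N.mulVecLin ≤ K' := by
    intro x hx
    rw [hmem]
    have hx' : N.mulVec x = 0 := hx
    have hxu : x u = 0 := by
      have := hrow x
      rw [hx'] at this
      simpa [hNvu] using this.symm
    intro w _ _
    simp [hx', hxu]
  have hker : LinearMap.ker φ = (LinearMap.ker N.mulVecLin).comap K'.subtype := by
    ext ⟨x, hx⟩
    have hx' := (hmem x).1 hx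
    simp only [φ, LinearMap.mem_ker, LinearMap.domRestrict_apply, hL, Submodule.mem_comap,
      Submodule.subtype_apply, Matrix.mulVecLin_apply, Prod.mk_eq_zero]
    constructor
    · rintro ⟨h1, h2⟩
      funext w
      by_cases hwu : w = u
      · subst hwu; exact h2
      by_cases hwv : w = v
      · subst hwv; rw [hrow, h1]; simp
      have := hx' w hwu hwv
      simpa [h1] using this
    · intro h
      have := hrow x
      rw [h] at this
      exact ⟨by simpa [hNvu] using this.symm, by rw [h]; rfl⟩
  have hsurj : Function.Surjective φ := by
    rintro ⟨a, b⟩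
    let x : V → ℂ := a • Pi.single u 1 + (b / N u v) • Pi.single v 1
    have hxN : ∀ w, N.mulVec x w = N w u * a + N w v * (b / N u v) := by
      intro w
      simp [x, Matrix.mulVec_add, Matrix.mulVec_smul, Matrix.col, mul_comm]
    have hxu : x u = a := by simp [x, huv]
    have hx : x ∈ K' := by
      rw [hmem]
      intro w h1 h2
      rw [hxN, hxu, hv' w h1]; ring
    refine ⟨⟨x, hx⟩, ?_⟩
    change L x = _
    rw [hL, hxN, hxu, huu]
    ext
    · rfl
    · simp; field_simp
  have h1 := LinearMap.finrank_range_add_finrank_ker φ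
  rw [LinearMap.range_eq_top.2 hsurj, finrank_top, hker] at h1
  have h2 : Module.finrank ℂ ((LinearMap.ker N.mulVecLin).comap K'.subtype)
      = Module.finrank ℂ (LinearMap.ker N.mulVecLin) :=
    (Submodule.comapSubtypeEquivOfLe hle).finrank_eq
  rw [h2] at h1
  simp at h1
  change Module.finrank ℂ K' = _
  omega

lemma core_aux {V : Type*} [Fintype V] [DecidableEq V] (n : ℕ) :
    ∀ (N : Matrix V V ℂ) (G : SimpleGraph V), (∀ u v, G.Adj u v ↔ N u v ≠ 0) → G.IsAcyclic →
    (Finset.univ.filter fun p : V × V => N p.1 p.2 ≠ 0).card = n →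
    (∃ f, IsMatchInv G f ∧ (Finset.univ.filter fun x => f x ≠ x).card
      + Module.finrank ℂ (LinearMap.ker N.mulVecLin) = Fintype.card V) ∧
    ∀ f, IsMatchInv G f → (Finset.univ.filter fun x => f x ≠ x).card
      + Module.finrank ℂ (LinearMap.ker N.mulVecLin) ≤ Fintype.card V := by
  induction n using Nat.strong_induction_on with
  | _ n ih =>
  intro N G hadj hac hn
  by_cases hne : ∃ a b, G.Adj a b
  · obtain ⟨u, v, hvu, hleaf⟩ := exists_leaf_aux G hac hne
    have huv : u ≠ v := hvu.ne'
    have hz : ∀ x y, ¬ G.Adj x y → N x y = 0 := fun x y h => by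
      by_contra h'; exact h ((hadj x y).2 h')
    have hfin := finrank_ker_delMat N u v huv (hz _ _ (G.loopless.irrefl u)) ((hadj _ _).1 hvu.symm)
      ((hadj _ _).1 hvu) (fun w hw => hz _ _ fun h => hw (hleaf w h))
      (fun w hw => hz _ _ fun h => hw (hleaf w h.symm))
    have hadj' : ∀ x y, (delPair G u v).Adj x y ↔ delMat N u v x y ≠ 0 := by
      intro x y
      simp only [delPair, delMat, hadj]
      split_ifs <;> tauto
    have hac' : (delPair G u v).IsAcyclic := hac.anti (fun x y h => h.1)
    have hlt : (Finset.univ.filter fun p : V × V => delMat N u v p.1 p.2 ≠ 0).card < n := by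
      rw [← hn]
      apply Finset.card_lt_card
      rw [Finset.ssubset_iff_of_subset]
      · refine ⟨(v, u), ?_, ?_⟩
        · simpa using (hadj _ _).1 hvu
        · simp [delMat]
      · intro p
        simp only [Finset.mem_filter, Finset.mem_univ, true_and, ← hadj, ← hadj']
        exact fun h => h.1
    obtain ⟨⟨f, hf, hfc⟩, hub⟩ := ih _ hlt _ _ hadj' hac' rfl
    rw [hfin] at hfc
    refine ⟨?_, ?_⟩
    · have hfu : f u = u := by
        by_contra h
        exact (hf.2 u h).2.1 rfl
      have hfv : f v = v := by
        by_contra h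
        exact (hf.2 v h).2.2.1 rfl
      refine ⟨fun x => if x = u then v else if x = v then u else f x, ⟨?_, ?_⟩, ?_⟩
      · intro x
        have := hf.1 x
        have h1 : f x = u → x = u := fun h => by rw [← this, h, hfu]
        have h2 : f x = v → x = v := fun h => by rw [← this, h, hfv]
        dsimp only
        grind
      · intro x
        dsimp only
        split_ifs with h1 h2
        · subst h1; exact fun _ => hvu.symm
        · subst h2; exact fun _ => hvu
        · exact fun h => (hf.2 x h).1
      · have : (Finset.univ.filter fun x => (if x = u then v else if x = v then u else f x) ≠ x)
            = insert u (insert v (Finset.univ.filter fun x => f x ≠ x)) := by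
          ext x
          simp only [Finset.mem_filter, Finset.mem_univ, true_and, Finset.mem_insert]
          grind
        rw [this, Finset.card_insert_of_notMem (by simp [huv, hfu]),
          Finset.card_insert_of_notMem (by simp [hfv])]
        omega
    · intro g hg
      have hgv : g v = v ∨ g v = u := by
        by_cases h : g v = v
        · exact Or.inl h
        · exact Or.inr (hleaf _ (hg.2 v h))
      have hgg := hg.1
      have key := hub (fun x => if x = u ∨ x = v ∨ x = g u then x else g x) ⟨?_, ?_⟩
      · rw [hfin] at key
        have hsub : (Finset.univ.filter fun x => g x ≠ x) ⊆ insert u (insert (g u)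
            (Finset.univ.filter fun x => (if x = u ∨ x = v ∨ x = g u then x else g x) ≠ x)) := by
          intro x
          simp only [Finset.mem_filter, Finset.mem_univ, true_and, Finset.mem_insert]
          grind
        have h1 := Finset.card_le_card hsub
        have h2 := Finset.card_insert_le u (insert (g u)
            (Finset.univ.filter fun x => (if x = u ∨ x = v ∨ x = g u then x else g x) ≠ x))
        have h3 := Finset.card_insert_le (g u)
            (Finset.univ.filter fun x => (if x = u ∨ x = v ∨ x = g u then x else g x) ≠ x)
        omega
      · intro x
        dsimp only
        grind
      · intro x
        dsimp only
        split_ifs with h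
        · intro h'; exact absurd rfl h'
        · intro h'
          have := hg.2 x h'
          refine ⟨this, ?_, ?_, ?_, ?_⟩ <;> grind
  · have hN : N = 0 := by
      ext x y
      by_contra h
      exact hne ⟨x, y, (hadj x y).2 h⟩
    have hk : Module.finrank ℂ (LinearMap.ker N.mulVecLin) = Fintype.card V := by
      rw [hN, Matrix.mulVecLin_zero, LinearMap.ker_zero, finrank_top]
      simp
    have hs : ∀ f, IsMatchInv G f → (Finset.univ.filter fun x => f x ≠ x) = ∅ := by
      intro f hf
      rw [Finset.filter_eq_empty_iff]
      intro x _ h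
      exact hne ⟨_, _, hf.2 x h⟩
    refine ⟨⟨id, ⟨fun _ => rfl, fun x h => absurd rfl h⟩, ?_⟩, ?_⟩
    · rw [hk]; simp
    · intro f hf
      rw [hs f hf, hk]; simp

lemma card_match_aux {V : Type*} [Fintype V] [DecidableEq V] (G : SimpleGraph V) (M : G.Subgraph)
    (f : V → V) (h : ∀ x y, M.Adj x y ↔ f x ≠ x ∧ f x = y) :
    2 * M.edgeSet.ncard = (Finset.univ.filter fun x => f x ≠ x).card := by
  classical
  have h1 := SimpleGraph.two_mul_card_edgeFinset (G := M.spanningCoe)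
  have h2 : M.edgeSet.ncard = M.spanningCoe.edgeFinset.card := by
    rw [← Set.ncard_coe_finset, SimpleGraph.coe_edgeFinset]
    simp
  rw [h2, h1]
  symm
  apply Finset.card_bij (fun x _ => (x, f x))
  · intro x hx
    simp at hx
    simp [h, hx]
  · intro a _ b _ hab
    exact (Prod.mk.inj hab).1
  · rintro ⟨a, b⟩ hb
    simp [h] at hb
    exact ⟨a, by simpa using hb.1, by simp [hb.2]⟩

lemma exists_inv_of_matching {V : Type*} (G : SimpleGraph V) (M : G.Subgraph)
    (hM : M.IsMatching) :
    ∃ f, IsMatchInv G f ∧ ∀ x y, M.Adj x y ↔ f x ≠ x ∧ f x = y := by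
  classical
  let f : V → V := fun x => if h : ∃ w, M.Adj x w then h.choose else x
  have h : ∀ x y, M.Adj x y ↔ f x ≠ x ∧ f x = y := by
    intro x y
    by_cases h : ∃ w, M.Adj x w
    · have hf : f x = h.choose := by simp [f, h]
      have hs : M.Adj x (f x) := hf ▸ h.choose_spec
      constructor
      · intro hy
        exact ⟨(M.adj_sub hs).ne', hM.eq_of_adj_left hs hy⟩
      · rintro ⟨_, rfl⟩
        exact hs
    · have hf : f x = x := by simp [f, h]
      constructor
      · intro hy; exact absurd ⟨y, hy⟩ h
      · intro hy; exact absurd hf hy.1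
  refine ⟨f, ⟨?_, ?_⟩, h⟩
  · intro x
    by_cases hx : f x = x
    · rw [hx, hx]
    · exact ((h _ _).1 ((h x (f x)).2 ⟨hx, rfl⟩).symm).2
  · intro x hx
    exact ((h x (f x)).2 ⟨hx, rfl⟩).adj_sub

lemma exists_matching_of_inv {V : Type*} (G : SimpleGraph V) (f : V → V) (hf : IsMatchInv G f) :
    ∃ M : G.Subgraph, M.IsMatching ∧ ∀ x y, M.Adj x y ↔ f x ≠ x ∧ f x = y := by
  refine ⟨{ verts := {x | f x ≠ x}
            Adj := fun x y => f x ≠ x ∧ f x = y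
            adj_sub := ?_
            edge_vert := ?_
            symm := ?_ }, ?_, fun _ _ => Iff.rfl⟩
  · rintro x y ⟨h, rfl⟩
    exact hf.2 x h
  · intro x y h
    exact h.1
  · constructor
    rintro x y ⟨h, rfl⟩
    rw [hf.1]
    exact ⟨fun h' => h h'.symm, rfl⟩
  · intro x hx
    exact ⟨f x, ⟨hx, rfl⟩, fun y hy => hy.2.symm⟩

/-- If the underlying graph of a mixed graph on `n` vertices is a tree `T`,
then the nullity of its N-matrix equals `n − 2μ(T)`, where `μ(T)` is the matching number. -/
theorem nullity_of_mixed_tree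
    {V : Type*} [Fintype V] [DecidableEq V]
    (N : Matrix V V ℂ) (hherm : N.IsHermitian)
    (hdiag : ∀ u, N u u = 0)
    (hent : ∀ u v, N u v ∈ ({0, 1, ω6, star ω6} : Set ℂ))
    (G : SimpleGraph V) (hadj : ∀ u v, G.Adj u v ↔ N u v ≠ 0)
    (htree : G.IsTree)
    (μ : ℕ)
    (hμ : IsGreatest {k : ℕ | ∃ M : G.Subgraph, M.IsMatching ∧ M.edgeSet.ncard = k} μ) :
    Module.finrank ℂ ↥(LinearMap.ker N.mulVecLin) = Fintype.card V - 2 * μ := by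
  obtain ⟨⟨f, hf, hfc⟩, hub⟩ := core_aux _ N G hadj htree.isAcyclic rfl
  obtain ⟨M, hM, hMf⟩ := exists_matching_of_inv G f hf
  have h1 := card_match_aux G M f hMf
  have h2 := hμ.2 ⟨M, hM, rfl⟩
  obtain ⟨M', hM', hMμ⟩ := hμ.1
  obtain ⟨g, hg, hgM⟩ := exists_inv_of_matching G M' hM'
  have h3 := card_match_aux G M' g hgM
  have h4 := hub g hg
  omega
end

section
/- Let N be the N-matrix of a mixed graph on vertex set V containing a pendant edge: there are vertices u, v ∈ V such that N_{vu} ≠ 0 and N_{vw} = 0 for all w ≠ u (v has exactly one neighbour, namely u). Let N' be the principal submatrix of N indexed by V ∖ {u, v}. Then dim ker N = dim ker N' (equivalently, rank N = rank N' + 2). -/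
open Matrix Complex

theorem sum_split_two {V : Type*} [Fintype V] [DecidableEq V] (u v : V) (huv : u ≠ v)
    (f : V → ℂ) :
    ∑ w, f w = f u + f v + ∑ x : {w : V // w ≠ u ∧ w ≠ v}, f x := by
  have h1 : ∑ x : {w : V // w ≠ u ∧ w ≠ v}, f x
      = ∑ w ∈ (Finset.univ.erase u).erase v, f w := by
    symm
    apply Finset.sum_subtype
    intro x
    simp [and_comm]
  rw [h1, ← Finset.add_sum_erase Finset.univ f (Finset.mem_univ u),
    ← Finset.add_sum_erase (Finset.univ.erase u) f (a := v) (by simp [huv.symm]), add_assoc]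

/-- If a mixed graph has a pendant edge `uv` (the vertex `v` has `u` as its
unique neighbour), then the nullity of its N-matrix equals the nullity of the principal
submatrix obtained by deleting the rows and columns of both `u` and `v`. -/
theorem nullity_delete_pendant_edge
    {V : Type*} [Fintype V] [DecidableEq V]
    (N : Matrix V V ℂ) (hherm : N.IsHermitian)
    (hdiag : ∀ u, N u u = 0)
    (hent : ∀ u v, N u v ∈ ({0, 1, ω6, star ω6} : Set ℂ))
    (u v : V)
    (hpend : N v u ≠ 0)
    (honly : ∀ w, w ≠ u → N v w = 0) :
    Module.finrank ℂ ↥(LinearMap.ker N.mulVecLin) =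
      Module.finrank ℂ ↥(LinearMap.ker
        (N.submatrix (fun x : {w : V // w ≠ u ∧ w ≠ v} => (x : V))
          (fun x : {w : V // w ≠ u ∧ w ≠ v} => (x : V))).mulVecLin) := by
  have huv : u ≠ v := by
    rintro rfl
    exact hpend (hdiag u)
  have hcol : ∀ w, w ≠ u → N w v = 0 := fun w hw => by
    rw [← hherm.apply w v, honly w hw, star_zero]
  have huv0 : N u v ≠ 0 := by
    rw [← hherm.apply u v]
    exact star_ne_zero.mpr hpend
  have hmul : ∀ (x : V → ℂ) (w : V), (N *ᵥ x) w = N w u * x u + N w v * x v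
      + ∑ y : {w : V // w ≠ u ∧ w ≠ v}, N w y * x y := fun x w =>
    sum_split_two u v huv (fun y => N w y * x y)
  have hv : ∀ x : V → ℂ, (N *ᵥ x) v = N v u * x u := fun x => by
    rw [hmul, hdiag v, Finset.sum_eq_zero]
    · ring
    · intro y _
      rw [honly y y.2.1, zero_mul]
  have hxu : ∀ x : V → ℂ, N *ᵥ x = 0 → x u = 0 := fun x hx => by
    have h := hv x
    rw [hx] at h
    simpa [hpend] using h.symm
  have hres : ∀ x ∈ LinearMap.ker N.mulVecLin,
      LinearMap.funLeft ℂ ℂ (fun x : {w : V // w ≠ u ∧ w ≠ v} => (x : V)) x ∈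
      LinearMap.ker (N.submatrix (fun x : {w : V // w ≠ u ∧ w ≠ v} => (x : V))
          (fun x : {w : V // w ≠ u ∧ w ≠ v} => (x : V))).mulVecLin := by
    intro x hx
    rw [LinearMap.mem_ker, Matrix.mulVecLin_apply] at hx ⊢
    ext w
    have h := hmul x w
    rw [hx, hxu x hx, hcol w w.2.1] at h
    simpa [Matrix.mulVec, dotProduct, LinearMap.funLeft_apply] using h.symm
  refine LinearEquiv.finrank_eq (LinearEquiv.ofBijective (LinearMap.restrict _ hres) ⟨?_, ?_⟩)
  · rw [injective_iff_map_eq_zero]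
    rintro ⟨x, hx⟩ h
    rw [LinearMap.mem_ker, Matrix.mulVecLin_apply] at hx
    have h0 : ∀ y : {w : V // w ≠ u ∧ w ≠ v}, x y = 0 := fun y =>
      congrFun (congrArg Subtype.val h) y
    have h2 := hmul x u
    rw [hx] at h2
    have hxv : x v = 0 := by
      simpa [h0, hdiag, huv0] using h2.symm
    ext w
    change x w = 0
    by_cases h3 : w = u
    · rw [h3, hxu x hx]
    by_cases h4 : w = v
    · rw [h4, hxv]
    exact h0 ⟨w, h3, h4⟩
  · rintro ⟨z, hz⟩
    rw [LinearMap.mem_ker, Matrix.mulVecLin_apply] at hz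
    let x : V → ℂ := fun w => if h : w ≠ u ∧ w ≠ v then z ⟨w, h⟩ else
      if w = u then 0 else
        - (∑ y : {w : V // w ≠ u ∧ w ≠ v}, N u y * z y) / N u v
    have hx1 : ∀ y : {w : V // w ≠ u ∧ w ≠ v}, x y = z y := fun y => by
      simp only [x]
      rw [dif_pos y.2]
    have hx2 : x u = 0 := by simp [x]
    have hx3 : x v = - (∑ y : {w : V // w ≠ u ∧ w ≠ v}, N u y * z y) / N u v := by
      simp [x, huv.symm]
    refine ⟨⟨x, ?_⟩, ?_⟩
    · rw [LinearMap.mem_ker, Matrix.mulVecLin_apply]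
      ext w
      by_cases h3 : w = u
      · rw [h3, hmul, hx2, hx3]
        simp only [hx1, Pi.zero_apply]
        field_simp
        ring
      by_cases h4 : w = v
      · rw [h4, hv, hx2, mul_zero, Pi.zero_apply]
      · rw [hmul, hx2, hcol w h3]
        simp only [hx1]
        have h5 := congrFun hz ⟨w, h3, h4⟩
        simpa [Matrix.mulVec, dotProduct] using h5
    · ext y
      exact hx1 y
end

section
/- Let N be the N-matrix of a mixed graph whose underlying graph G is connected, and suppose the rank of N equals 2. Then G is a complete bipartite graph: there exists a partition of the vertex set V = A ⊔ B with A and B nonempty such that u and v are adjacent in G (i.e., N_{uv} ≠ 0) if and only if exactly one of u, v lies in A. -/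
open Matrix Complex

/-- Nonzero entries are unimodular sixth roots of unity. -/
theorem entry_facts (p : ℂ) (hp : p ∈ ({0, 1, ω6, star ω6} : Set ℂ)) (h0 : p ≠ 0) :
    p ^ 6 = 1 ∧ p * star p = 1 := by
  have hs : ((Real.sqrt 3 : ℝ) : ℂ) ^ 2 = 3 := by
    rw [← Complex.ofReal_pow, Real.sq_sqrt (by norm_num)]; norm_num
  have hstar : star ω6 = (1 - Complex.I * Real.sqrt 3) / 2 := by
    simp [ω6, Complex.conj_ofReal, sub_eq_add_neg]
  have hI : Complex.I ^ 2 = -1 := Complex.I_sq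
  have hprod : ω6 * star ω6 = 1 := by
    rw [hstar, ω6]; linear_combination (-1/4 : ℂ) * Complex.I ^ 2 * hs - (3/4) * hI
  have hsum : ω6 + star ω6 = 1 := by
    rw [hstar, ω6]; ring
  have hq : ω6 ^ 2 = ω6 - 1 := by
    linear_combination ω6 * hsum - hprod
  have h3 : ω6 ^ 3 = -1 := by
    linear_combination (ω6 + 1) * hq
  have h6 : ω6 ^ 6 = 1 := by
    linear_combination (ω6 ^ 3 - 1) * h3
  rcases hp with rfl | rfl | rfl | rfl
  · exact absurd rfl h0
  · simp
  · exact ⟨h6, hprod⟩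
  · refine ⟨?_, ?_⟩
    · rw [← star_pow, h6, star_one]
    · rw [star_star, mul_comm]; exact hprod

theorem minor_zero {V : Type*} [Fintype V] [DecidableEq V]
    (N : Matrix V V ℂ) (hrank : N.rank = 2) (r c : Fin 3 → V) :
    (N.submatrix r c).det = 0 := by
  by_contra h
  have h1 := Matrix.rank_of_isUnit (N.submatrix r c)
    ((Matrix.isUnit_iff_isUnit_det _).2 (isUnit_iff_ne_zero.2 h))
  have h2 := N.rank_submatrix_le r c
  simp at h1
  omega

/-- If the underlying graph of a mixed graph is connected and its N-matrix
has rank `2`, then the underlying graph is complete bipartite. -/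
theorem rank_two_underlying_complete_bipartite
    {V : Type*} [Fintype V] [DecidableEq V]
    (N : Matrix V V ℂ) (hherm : N.IsHermitian)
    (hdiag : ∀ u, N u u = 0)
    (hent : ∀ u v, N u v ∈ ({0, 1, ω6, star ω6} : Set ℂ))
    (G : SimpleGraph V) (hadj : ∀ u v, G.Adj u v ↔ N u v ≠ 0)
    (hconn : G.Connected)
    (hrank : N.rank = 2) :
    ∃ A B : Set V, A.Nonempty ∧ B.Nonempty ∧ Disjoint A B ∧ A ∪ B = Set.univ ∧
      ∀ u v, N u v ≠ 0 ↔ ((u ∈ A ∧ v ∈ B) ∨ (u ∈ B ∧ v ∈ A)) := by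
  have hst : ∀ x y, star (N x y) = N y x := fun x y => hherm.apply y x
  have hsymm : ∀ x y, N x y ≠ 0 → N y x ≠ 0 := by
    intro x y h
    rw [← hst x y]
    exact star_ne_zero.2 h
  obtain ⟨u, v, huv⟩ : ∃ u v, N u v ≠ 0 := by
    by_contra! h
    have : N = 0 := by ext i j; exact h i j
    rw [this] at hrank
    simp at hrank
  have hvu := hsymm u v huv
  have hne : u ≠ v := by rintro rfl; exact huv (hdiag u)
  have key : ∀ w z, N u v * N v u * N w z
      = N u v * N v z * N w u + N u z * N v u * N w v := by
    intro w z
    have h := minor_zero N hrank ![u, v, w] ![u, v, z]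
    rw [Matrix.det_fin_three] at h
    simp [hdiag] at h
    linear_combination -h
  have hdis : ∀ w, N w u ≠ 0 → N w v ≠ 0 → False := by
    intro w h1 h2
    have h3 := hsymm _ _ h2
    have k := key w w
    rw [hdiag] at k
    obtain ⟨a6, a1⟩ := entry_facts _ (hent u v) huv
    obtain ⟨b6, b1⟩ := entry_facts _ (hent v w) h3
    obtain ⟨c6, c1⟩ := entry_facts _ (hent w u) h1
    rw [hst] at a1 b1 c1
    have hx : (N u v * N v w * N w u) * (N u w * N v u * N w v) = 1 := by
      linear_combination (N v w * N w v * N w u * N u w) * a1 + (N w u * N u w) * b1 + c1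
    have h6 : (N u v * N v w * N w u) ^ 6 = 1 := by
      rw [mul_pow, mul_pow, a6, b6, c6]; norm_num
    generalize N u v * N v w * N w u = x at *
    have hx2 : x ^ 2 = -1 := by linear_combination -hx - x * k
    have : x ^ 6 = -1 := by
      calc x ^ 6 = (x ^ 2) ^ 3 := by ring
        _ = -1 := by rw [hx2]; norm_num
    rw [h6] at this
    norm_num at this
  have hnb : ∀ w, ∃ z, N w z ≠ 0 := by
    intro w
    haveI : Nontrivial V := ⟨u, v, hne⟩
    obtain ⟨t, ht⟩ := exists_ne w
    obtain ⟨p⟩ := hconn.preconnected w t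
    cases p with
    | nil => exact absurd rfl ht
    | cons h _ => exact ⟨_, (hadj _ _).1 h⟩
  refine ⟨{w | N w v ≠ 0}, {w | N w u ≠ 0}, ⟨u, huv⟩, ⟨v, hvu⟩, ?_, ?_, ?_⟩
  · rw [Set.disjoint_left]
    intro w h1 h2
    exact hdis w h2 h1
  · ext w
    simp only [Set.mem_union, Set.mem_setOf_eq, Set.mem_univ, iff_true]
    by_contra! h
    obtain ⟨z, hz⟩ := hnb w
    have k := key w z
    rw [h.1, h.2, mul_zero, mul_zero, add_zero] at k
    exact mul_ne_zero (mul_ne_zero huv hvu) hz k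
  · intro w z
    simp only [Set.mem_setOf_eq]
    have k := key w z
    constructor
    · intro h
      by_cases hw : N w u = 0
      · left
        rw [hw, mul_zero, zero_add] at k
        have := mul_ne_zero (mul_ne_zero huv hvu) h
        rw [k] at this
        exact ⟨right_ne_zero_of_mul this,
          hsymm _ _ (left_ne_zero_of_mul (left_ne_zero_of_mul this))⟩
      · right
        have hv : N w v = 0 := by by_contra h'; exact hdis w hw h'
        rw [hv, mul_zero, add_zero] at k
        have := mul_ne_zero (mul_ne_zero huv hvu) h
        rw [k] at this
        exact ⟨hw, hsymm _ _ (right_ne_zero_of_mul (left_ne_zero_of_mul this))⟩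
    · rintro (⟨h1, h2⟩ | ⟨h1, h2⟩) h0
      · have hw : N w u = 0 := by by_contra h'; exact hdis w h' h1
        rw [h0, hw, mul_zero, mul_zero, zero_add] at k
        exact mul_ne_zero (mul_ne_zero (hsymm _ _ h2) hvu) h1 k.symm
      · have hw : N w v = 0 := by by_contra h'; exact hdis w h1 h'
        rw [h0, hw, mul_zero, mul_zero, add_zero] at k
        exact mul_ne_zero (mul_ne_zero huv (hsymm _ _ h2)) h1 k.symm
end

section
/- Let N be the N-matrix of a mixed graph on a finite vertex set V. The following are equivalent: (a) every eigenvalue λ of N satisfies |λ| < √2; (b) every eigenvalue λ of N satisfies |λ| ≤ 1; (c) every vertex has degree at most 1, i.e., each row of N contains at most one nonzero entry (every connected component of the mixed graph is an undirected edge, an arc, or an isolated vertex). -/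
open Matrix Complex

lemma norm_omega6 : ‖ω6‖ = 1 := by
  have h3 : Real.sqrt 3 * Real.sqrt 3 = 3 := Real.mul_self_sqrt (by norm_num)
  have h : Complex.normSq ω6 = 1 := by
    unfold ω6
    rw [Complex.normSq_div]
    simp [Complex.normSq_apply, h3]
    norm_num
  rw [Complex.normSq_eq_norm_sq] at h
  nlinarith [norm_nonneg ω6]

lemma norm_entry {z : ℂ} (h : z ∈ ({0, 1, ω6, star ω6} : Set ℂ)) (h0 : z ≠ 0) : ‖z‖ = 1 := by
  rcases h with h | h | h | h
  · exact absurd h h0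
  · simp [h]
  · rw [h, norm_omega6]
  · have h' : z = star ω6 := h
    rw [h', norm_star, norm_omega6]

lemma eig_apply {V : Type*} [Fintype V] [DecidableEq V]
    (N : Matrix V V ℂ) (hherm : N.IsHermitian) (i u : V) :
    ∑ v, N u v * hherm.eigenvectorBasis i v =
      (hherm.eigenvalues i : ℂ) * hherm.eigenvectorBasis i u := by
  have h := congrFun (hherm.mulVec_eigenvectorBasis i) u
  simpa [Matrix.mulVec, dotProduct] using h

lemma eig_le_one {V : Type*} [Fintype V] [DecidableEq V]
    (N : Matrix V V ℂ) (hherm : N.IsHermitian)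
    (hent : ∀ u v, N u v ∈ ({0, 1, ω6, star ω6} : Set ℂ))
    (hdeg : ∀ u, {v | N u v ≠ 0}.ncard ≤ 1) (i : V) : |hherm.eigenvalues i| ≤ 1 := by
  have : Nonempty V := ⟨i⟩
  set x := hherm.eigenvectorBasis i with hx
  obtain ⟨u, hu⟩ := Finite.exists_max (fun v => ‖x v‖)
  have hpos : 0 < ‖x u‖ := by
    by_contra hc
    have h0 : x = 0 := by
      ext v
      have := hu v
      have h1 : ‖x v‖ ≤ 0 := this.trans (not_lt.mp hc)
      simpa using h1
    have h1 : ‖x‖ = 1 := hherm.eigenvectorBasis.orthonormal.1 i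
    rw [h0] at h1
    simp at h1
  have key : ‖∑ v, N u v * x v‖ ≤ ‖x u‖ := by
    have hsub := (Set.ncard_le_one (Set.toFinite _)).1 (hdeg u)
    by_cases hex : ∃ w, N u w ≠ 0
    · obtain ⟨w, hw⟩ := hex
      rw [Finset.sum_eq_single w]
      · rw [norm_mul, norm_entry (hent u w) hw, one_mul]
        exact hu w
      · intro b _ hb
        have : N u b = 0 := by
          by_contra hnb
          exact hb (hsub b hnb w hw)
        simp [this]
      · simp
    · push Not at hex
      simp [hex]
  rw [eig_apply N hherm i u, norm_mul, Complex.norm_real, Real.norm_eq_abs] at key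
  exact le_of_mul_le_mul_right (by simpa using key) hpos

lemma deg_le_one {V : Type*} [Fintype V] [DecidableEq V]
    (N : Matrix V V ℂ) (hherm : N.IsHermitian)
    (hent : ∀ u v, N u v ∈ ({0, 1, ω6, star ω6} : Set ℂ))
    (hlt : ∀ i, |hherm.eigenvalues i| < Real.sqrt 2) (u : V) :
    {v | N u v ≠ 0}.ncard ≤ 1 := by
  set b := hherm.eigenvectorBasis with hb
  -- the squares of the `u`-coordinates sum to one
  have h1 : ∑ i, ‖b i u‖ ^ 2 = 1 := by
    have h := b.sum_sq_norm_inner_left (EuclideanSpace.single u (1 : ℂ))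
    simpa [EuclideanSpace.inner_single_left] using h
  -- Parseval for the `u`-th row
  have h2 : ∑ i, (hherm.eigenvalues i) ^ 2 * ‖b i u‖ ^ 2 = ∑ v, ‖N u v‖ ^ 2 := by
    have h := b.sum_sq_norm_inner_left (WithLp.toLp 2 (fun v => star (N u v)))
    rw [EuclideanSpace.norm_sq_eq] at h
    simp only [norm_star] at h
    rw [← h]
    refine Finset.sum_congr rfl fun i _ => ?_
    have h3 : inner ℂ (WithLp.toLp 2 (fun v => star (N u v))) (b i) =
        (hherm.eigenvalues i : ℂ) * b i u := by
      rw [← eig_apply N hherm i u]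
      simp [PiLp.inner_apply, mul_comm, hb]
    rw [h3, norm_mul, Complex.norm_real, mul_pow, Real.norm_eq_abs, sq_abs]
  have h3 : ∑ v, ‖N u v‖ ^ 2 = (({v | N u v ≠ 0}.ncard : ℕ) : ℝ) := by
    classical
    rw [Set.ncard_eq_toFinset_card', Set.toFinset_ofPred, Finset.card_filter]
    push_cast
    refine Finset.sum_congr rfl fun v _ => ?_
    by_cases h0 : N u v = 0
    · simp [h0]
    · simp [h0, norm_entry (hent u v) h0]
  have hsq : ∀ i, (hherm.eigenvalues i) ^ 2 < 2 := by
    intro i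
    rw [← sq_abs]
    exact (Real.lt_sqrt (abs_nonneg _)).1 (hlt i)
  have h4 : ∑ i, (hherm.eigenvalues i) ^ 2 * ‖b i u‖ ^ 2 < ∑ i, 2 * ‖b i u‖ ^ 2 := by
    apply Finset.sum_lt_sum
    · intro i _
      exact mul_le_mul_of_nonneg_right (hsq i).le (sq_nonneg _)
    · by_contra hc
      push Not at hc
      have : ∑ i, ‖b i u‖ ^ 2 = 0 := by
        refine Finset.sum_eq_zero fun i hi => ?_
        nlinarith [hc i hi, hsq i, sq_nonneg ‖b i u‖]
      linarith
  rw [h2, h3, ← Finset.mul_sum, h1, mul_one] at h4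
  have : {v | N u v ≠ 0}.ncard < 2 := by exact_mod_cast h4
  omega

/-- For the N-matrix of a mixed graph the following are equivalent:
(a) every eigenvalue has absolute value `< √2`; (b) every eigenvalue has absolute value `≤ 1`;
(c) every vertex has degree at most `1`. -/
theorem spectral_radius_lt_sqrt_two_iff
    {V : Type*} [Fintype V] [DecidableEq V]
    (N : Matrix V V ℂ) (hherm : N.IsHermitian)
    (hdiag : ∀ u, N u u = 0)
    (hent : ∀ u v, N u v ∈ ({0, 1, ω6, star ω6} : Set ℂ)) :
    ((∀ i, |hherm.eigenvalues i| < Real.sqrt 2) ↔ (∀ i, |hherm.eigenvalues i| ≤ 1)) ∧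
    ((∀ i, |hherm.eigenvalues i| ≤ 1) ↔ (∀ u, {v | N u v ≠ 0}.ncard ≤ 1)) := by
  have hs : (1 : ℝ) < Real.sqrt 2 := by
    rw [Real.lt_sqrt] <;> norm_num
  have hba : (∀ i, |hherm.eigenvalues i| ≤ 1) → ∀ i, |hherm.eigenvalues i| < Real.sqrt 2 :=
    fun h i => (h i).trans_lt hs
  exact ⟨⟨fun h => eig_le_one N hherm hent (deg_le_one N hherm hent h), hba⟩,
    fun h => deg_le_one N hherm hent (hba h), eig_le_one N hherm hent⟩
end

section
/- Let N be the N-matrix of a mixed graph on a finite vertex set V with underlying graph G. Then every eigenvalue λ of N satisfies |λ| < √3 if and only if every connected component of G is either a path on at most 4 vertices (including the one-vertex path), or a cycle on 4 vertices whose weight (the product of the N-entries along the cycle in one cyclic direction) equals −1. -/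
open Matrix Complex

lemma w6_eq : (ω6 : ℂ) = ⟨1/2, Real.sqrt 3 / 2⟩ := by
  unfold ω6
  apply Complex.ext <;> simp

lemma w6_sq : ω6 ^ 2 = ω6 - 1 := by
  have h : Real.sqrt 3 * Real.sqrt 3 = 3 := Real.mul_self_sqrt (by norm_num)
  rw [w6_eq, pow_two]
  apply Complex.ext
  · simp; nlinarith
  · simp; ring

lemma pow_six_of_sq {z : ℂ} (h : z ^ 2 = z - 1) : z ^ 6 = 1 := by
  linear_combination (z^4 + z^3 - z - 1) * h

lemma ent_pow_six {z : ℂ} (h : z ∈ ({0, 1, ω6, star ω6} : Set ℂ)) (hz : z ≠ 0) : z ^ 6 = 1 := by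
  have h6 := pow_six_of_sq w6_sq
  rcases h with h | h | h | h
  · exact absurd h hz
  · rw [h]; simp
  · rw [h]; exact h6
  · rw [Set.mem_singleton_iff] at h
    rw [h, ← star_pow, h6]; simp

lemma norm_of_pow_six {z : ℂ} (h : z ^ 6 = 1) : ‖z‖ = 1 :=
  Complex.norm_eq_one_of_pow_eq_one h (by norm_num)

lemma sum_eq_zero_of_roots {p q : ℂ} (hp : p ^ 6 = 1) (hq : q ^ 6 = 1) (h : ‖p + q‖ < 1) :
    p + q = 0 := by
  have hp1 := norm_of_pow_six hp
  have hq1 := norm_of_pow_six hq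
  have hf : (p - q) * ((p + q) * ((p^2 + p*q + q^2) * (p^2 - p*q + q^2))) = 0 := by
    linear_combination hp - hq
  have h0 : 0 ≤ ‖p + q‖ := norm_nonneg _
  rcases mul_eq_zero.1 hf with h1 | h1
  · have : p = q := sub_eq_zero.1 h1
    subst this
    rw [← two_mul, norm_mul, hp1] at h
    norm_num at h
  rcases mul_eq_zero.1 h1 with h1 | h1
  · exact h1
  rcases mul_eq_zero.1 h1 with h1 | h1
  · have h2 : (p + q)^2 = p * q := by linear_combination h1
    have h3 := congrArg norm h2
    rw [norm_pow, norm_mul, hp1, hq1] at h3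
    nlinarith
  · have h2 : (p + q)^2 = 3 * (p * q) := by linear_combination h1
    have h3 := congrArg norm h2
    rw [norm_pow, norm_mul, norm_mul, hp1, hq1] at h3
    norm_num at h3
    nlinarith

section
open scoped ComplexOrder
variable {V : Type*} [Fintype V] [DecidableEq V]

lemma posDef_three_sub (N : Matrix V V ℂ) (hherm : N.IsHermitian)
    (h : ∀ i, |hherm.eigenvalues i| < Real.sqrt 3) :
    ((3 : ℂ) • (1 : Matrix V V ℂ) - N * N).PosDef := by
  have hD : (diagonal (fun i => ((3 - hherm.eigenvalues i ^ 2 : ℝ) : ℂ))).PosDef := by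
    rw [Matrix.posDef_diagonal_iff]
    intro i
    rw [Complex.zero_lt_real]
    have := (Real.lt_sqrt (abs_nonneg _)).1 (h i)
    rw [sq_abs] at this
    linarith
  have key : (3 : ℂ) • (1 : Matrix V V ℂ) - N * N =
      Unitary.conjStarAlgAut ℂ _ hherm.eigenvectorUnitary
        (diagonal (fun i => ((3 - hherm.eigenvalues i ^ 2 : ℝ) : ℂ))) := by
    have hd : diagonal (fun i => ((3 - hherm.eigenvalues i ^ 2 : ℝ) : ℂ)) =
        (3 : ℂ) • (1 : Matrix V V ℂ) -
          diagonal (RCLike.ofReal ∘ hherm.eigenvalues) * diagonal (RCLike.ofReal ∘ hherm.eigenvalues)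
         := by
      ext i j
      by_cases hij : i = j
      · subst hij; simp [pow_two]
      · simp [hij]
    rw [hd, map_sub, map_mul, ← hherm.spectral_theorem, map_smul, map_one]
  rw [key, Unitary.conjStarAlgAut_apply]
  exact (Matrix.IsUnit.posDef_star_right_conjugate_iff (Unitary.isUnit_coe)).2 hD

variable (N : Matrix V V ℂ) (hherm : N.IsHermitian)
    (hent : ∀ u v, N u v ∈ ({0, 1, ω6, star ω6} : Set ℂ))
include hherm hent

lemma mul_swap (u v : V) (h : N u v ≠ 0) : N u v * N v u = 1 := by
  have h1 := norm_of_pow_six (ent_pow_six (hent u v) h)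
  rw [← hherm.apply v u, Complex.star_def, Complex.mul_conj, Complex.normSq_eq_norm_sq, h1]
  simp

lemma ne_swap (u v : V) (h : N u v ≠ 0) : N v u ≠ 0 := by
  intro h0
  have := mul_swap N hherm hent u v h
  rw [h0] at this; simp at this

lemma diag_eq (u : V) : (N * N) u u = ((Finset.univ.filter (fun v => N u v ≠ 0)).card : ℂ) := by
  rw [Matrix.mul_apply, Finset.card_filter]
  push_cast
  refine Finset.sum_congr rfl fun v _ => ?_
  split_ifs with h
  · exact mul_swap N hherm hent u v h
  · rw [not_not.1 h]; simp

variable (hP : ((3 : ℂ) • (1 : Matrix V V ℂ) - N * N).PosDef)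
include hP

lemma deg_le_two (u : V) : (Finset.univ.filter (fun v => N u v ≠ 0)).card ≤ 2 := by
  have h := hP.diag_pos (i := u)
  rw [Matrix.sub_apply, diag_eq N hherm hent] at h
  simp only [Matrix.smul_apply, Matrix.one_apply_eq, smul_eq_mul, mul_one, sub_pos] at h
  have : (Finset.univ.filter (fun v => N u v ≠ 0)).card < 3 := by exact_mod_cast h
  omega

lemma nbr_eq (u a b : V) (hab : a ≠ b) (ha : N u a ≠ 0) (hb : N u b ≠ 0) :
    (Finset.univ.filter (fun v => N u v ≠ 0)) = {a, b} := by
  symm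
  apply Finset.eq_of_subset_of_card_le
  · intro x hx
    simp only [Finset.mem_insert, Finset.mem_singleton] at hx
    rcases hx with rfl | rfl <;> simp [ha, hb]
  · rw [Finset.card_pair hab]
    exact deg_le_two N hherm hent hP u

lemma nbr_cases (u a b x : V) (hab : a ≠ b) (ha : N u a ≠ 0) (hb : N u b ≠ 0) (hx : N u x ≠ 0) :
    x = a ∨ x = b := by
  have h := nbr_eq N hherm hent hP u a b hab ha hb
  have : x ∈ (Finset.univ.filter (fun v => N u v ≠ 0)) := by simp [hx]
  rw [h] at this
  simpa using this

lemma norm_lt_one (u w a b c d : V) (huw : u ≠ w) (hab : a ≠ b) (hcd : c ≠ d)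
    (hua : N u a ≠ 0) (hub : N u b ≠ 0) (hwa : N w c ≠ 0) (hwd : N w d ≠ 0) :
    ‖N u a * N a w + N u b * N b w‖ < 1 := by
  have hM : (N * N) u w = N u a * N a w + N u b * N b w := by
    rw [Matrix.mul_apply, ← Finset.sum_pair (f := fun z => N u z * N z w) hab]
    symm
    apply Finset.sum_subset (Finset.subset_univ _)
    intro x _ hx
    by_contra hne
    apply hx
    have := nbr_cases N hherm hent hP u a b x hab hua hub (left_ne_zero_of_mul hne)
    simpa using this
  have hNN : (N * N).IsHermitian := by
    have := Matrix.isHermitian_mul_conjTranspose_self N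
    rwa [hherm.eq] at this
  have hinj : Function.Injective ![u, w] := by
    intro i j
    fin_cases i <;> fin_cases j <;> simp [huw, huw.symm]
  have h := (hP.submatrix hinj).det_pos
  rw [Matrix.det_fin_two] at h
  simp only [Matrix.submatrix_apply, Matrix.sub_apply, Matrix.cons_val_zero, Matrix.cons_val_one,
    Matrix.smul_apply, Matrix.one_apply_eq, Matrix.one_apply_ne huw, Matrix.one_apply_ne huw.symm,
    diag_eq N hherm hent, nbr_eq N hherm hent hP u a b hab hua hub,
    nbr_eq N hherm hent hP w c d hcd hwa hwd, Finset.card_pair hab, Finset.card_pair hcd] at h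
  rw [← hNN.apply w u, Complex.star_def, hM] at h
  set z := N u a * N a w + N u b * N b w
  have h2 : ((3:ℂ) • 1 - ((2:ℕ):ℂ)) * ((3:ℂ) • 1 - ((2:ℕ):ℂ)) -
      ((3:ℂ) • 0 - z) * ((3:ℂ) • 0 - (starRingEnd ℂ) z) = ((1 - ‖z‖^2 : ℝ) : ℂ) := by
    have := Complex.mul_conj z
    rw [Complex.normSq_eq_norm_sq] at this
    push_cast at this ⊢
    simp only [smul_eq_mul]
    linear_combination -this
  rw [h2, Complex.zero_lt_real] at h
  nlinarith [norm_nonneg z]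

lemma common_nbr (u w a b d : V) (huw : u ≠ w) (hab : a ≠ b) (had : a ≠ d)
    (hua : N u a ≠ 0) (hub : N u b ≠ 0) (hwa : N w a ≠ 0) (hwd : N w d ≠ 0) :
    b = d ∧ N u a * N a w + N u b * N b w = 0 := by
  have h := norm_lt_one N hherm hent hP u w a b a d huw hab had hua hub hwa hwd
  have haw := ne_swap N hherm hent _ _ hwa
  have e1 := ent_pow_six (hent u a) hua
  have e2 := ent_pow_six (hent a w) haw
  have e3 : (N u a * N a w)^6 = 1 := by rw [mul_pow, e1, e2]; simp
  have hbw : N b w ≠ 0 := by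
    intro h0
    rw [h0, mul_zero, add_zero, norm_of_pow_six e3] at h
    exact lt_irrefl _ h
  refine ⟨?_, ?_⟩
  · rcases nbr_cases N hherm hent hP w a d b had hwa hwd (ne_swap N hherm hent _ _ hbw) with h1 | h1
    · exact absurd h1.symm hab
    · exact h1
  · refine sum_eq_zero_of_roots e3 ?_ h
    rw [mul_pow, ent_pow_six (hent u b) hub, ent_pow_six (hent b w) hbw]; simp

end

lemma cycle_alg {a b c d a' c' d' y1 y2 y3 y4 : ℂ} {l : ℂ}
    (ha : a * a' = 1) (hc : c * c' = 1) (hd : d * d' = 1)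
    (hw : a * b * c * d = -1)
    (h1 : l * y1 = a * y2 + d' * y4) (h2 : l * y2 = a' * y1 + b * y3)
    (h4 : l * y4 = d * y1 + c' * y3) : l ^ 2 * y1 = 2 * y1 := by
  have hz : a * b + d' * c' = 0 := by
    linear_combination d' * c' * hw - a * b * d * d' * hc - a * b * hd
  linear_combination l * h1 + a * h2 + d' * h4 + y1 * ha + y1 * hd + y3 * hz

section
variable {V : Type*} (G : SimpleGraph V)

lemma closed_reach (S : Set V) (hS : ∀ u ∈ S, ∀ w, G.Adj u w → w ∈ S) {v w : V}
    (h : G.Reachable v w) (hv : v ∈ S) : w ∈ S := by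
  obtain ⟨p⟩ := h
  induction p with
  | nil => exact hv
  | cons hadj _ ih => exact ih (hS _ hv _ hadj)

lemma supp_eq (c : G.ConnectedComponent) (S : Set V)
    (hS : ∀ u ∈ S, ∀ w, G.Adj u w → w ∈ S) (v : V) (hv : v ∈ S) (hvc : v ∈ c.supp)
    (hr : ∀ w ∈ S, G.Reachable v w) : c.supp = S := by
  rw [SimpleGraph.ConnectedComponent.mem_supp_iff] at hvc
  ext w
  rw [SimpleGraph.ConnectedComponent.mem_supp_iff, ← hvc, SimpleGraph.ConnectedComponent.eq]
  exact ⟨fun h => closed_reach G S hS h.symm hv, fun h => (hr w h).symm⟩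

lemma comp_path (c : G.ConnectedComponent) (k : ℕ) (f : Fin k → V) (hinj : Function.Injective f)
    (hadj : ∀ i j, G.Adj (f i) (f j) ↔ (SimpleGraph.pathGraph k).Adj i j)
    (hcl : ∀ i w, G.Adj (f i) w → ∃ j, f j = w) (i0 : Fin k) (hi0 : f i0 ∈ c.supp) :
    Nonempty ((G.induce c.supp) ≃g SimpleGraph.pathGraph k) := by
  have hs : c.supp = Set.range f := by
    refine supp_eq G c (Set.range f) ?_ (f i0) ⟨i0, rfl⟩ hi0 ?_
    · rintro _ ⟨i, rfl⟩ w hw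
      exact hcl i w hw
    · rintro _ ⟨i, rfl⟩
      let φ : SimpleGraph.pathGraph k →g G := ⟨f, fun {a b} h => (hadj a b).2 h⟩
      exact (SimpleGraph.pathGraph_preconnected k i0 i).map φ
  rw [hs]
  refine ⟨SimpleGraph.Iso.symm ⟨Equiv.ofInjective f hinj, ?_⟩⟩
  intro i j
  simp [hadj]

lemma path_bound (k : ℕ) (hk : k ≤ 4) (r : Fin k → ℝ) (hr : ∀ i, 0 ≤ r i) (L : ℝ)
    (hL : 1.7 ≤ L)
    (h : ∀ i, L * r i ≤ ∑ j, if (i.val + 1 = j.val ∨ j.val + 1 = i.val) then r j else 0) (i : Fin k) :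
    r i = 0 := by
  have h' : ∀ i, 1.7 * r i ≤
      ∑ j, if (i.val + 1 = j.val ∨ j.val + 1 = i.val) then r j else 0 := fun i =>
    le_trans (mul_le_mul_of_nonneg_right hL (hr i)) (h i)
  clear h
  refine le_antisymm ?_ (hr i)
  interval_cases k
  · exact i.elim0
  · have h0 := h' 0
    simp at h0
    fin_cases i <;> simp <;> linarith
  · have h0 := h' 0
    have h1 := h' 1
    simp [Fin.sum_univ_succ] at h0 h1
    fin_cases i <;> simp <;> linarith
  · have h0 := h' 0
    have h1 := h' 1
    have h2 := h' 2
    simp [Fin.sum_univ_succ] at h0 h1 h2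
    have e0 := hr 0
    have e1 := hr 1
    have e2 := hr 2
    fin_cases i <;> simp <;> linarith
  · have h0 := h' 0
    have h1 := h' 1
    have h2 := h' 2
    have h3 := h' 3
    simp [Fin.sum_univ_succ] at h0 h1 h2 h3
    have e0 := hr 0
    have e1 := hr 1
    have e2 := hr 2
    have e3 := hr 3
    fin_cases i <;> simp <;> linarith

lemma sum_supp [Fintype V] [DecidableEq V] (N : Matrix V V ℂ)
    (hadj : ∀ u v, G.Adj u v ↔ N u v ≠ 0)
    (c : G.ConnectedComponent) (k : ℕ) (f : Fin k → V) (hinj : Function.Injective f)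
    (hs : c.supp = Set.range f) (x : V → ℂ) (u : V) (hu : u ∈ c.supp) :
    (N *ᵥ x) u = ∑ j, N u (f j) * x (f j) := by
  rw [Matrix.mulVec, dotProduct]
  rw [← Finset.sum_image (s := Finset.univ) (g := f) (f := fun z => N u z * x z)
    (fun _ _ _ _ h => hinj h)]
  symm
  apply Finset.sum_subset (Finset.subset_univ _)
  intro z _ hz
  by_contra hne
  apply hz
  have ha : G.Adj u z := (hadj u z).2 (left_ne_zero_of_mul hne)
  have : z ∈ c.supp := (SimpleGraph.ConnectedComponent.mem_supp_congr_adj c ha).1 hu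
  rw [hs] at this
  obtain ⟨j, rfl⟩ := this
  exact Finset.mem_image_of_mem _ (Finset.mem_univ _)

end

section
variable {V : Type*} [Fintype V] [DecidableEq V]
    (N : Matrix V V ℂ) (hherm : N.IsHermitian)
    (hent : ∀ u v, N u v ∈ ({0, 1, ω6, star ω6} : Set ℂ))
    (G : SimpleGraph V) (hadj : ∀ u v, G.Adj u v ↔ N u v ≠ 0)
include hherm hent hadj

lemma backward_path (c : G.ConnectedComponent) (k : ℕ) (hk : k ≤ 4)
    (e : (G.induce c.supp) ≃g SimpleGraph.pathGraph k) (x : V → ℂ) (l : ℝ)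
    (hx : N *ᵥ x = l • x) (u : V) (hu : u ∈ c.supp) (hxu : x u ≠ 0) : |l| < Real.sqrt 3 := by
  by_contra hl
  have hl : (1.7 : ℝ) ≤ |l| := by
    refine le_trans ?_ (not_lt.1 hl)
    apply Real.le_sqrt_of_sq_le
    norm_num
  let f : Fin k → V := fun i => (e.symm i : V)
  have hinj : Function.Injective f := fun i j h => e.symm.injective (Subtype.ext h)
  have hs : c.supp = Set.range f := by
    ext w
    constructor
    · intro hw
      exact ⟨e ⟨w, hw⟩, by simp [f]⟩
    · rintro ⟨i, rfl⟩
      exact (e.symm i).2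
  have hpa : ∀ i j, G.Adj (f i) (f j) ↔ (i.val + 1 = j.val ∨ j.val + 1 = i.val) := by
    intro i j
    rw [← SimpleGraph.pathGraph_adj, ← e.symm.map_adj_iff]
    simp [f]
  rw [hs] at hu
  obtain ⟨i, rfl⟩ := hu
  have := path_bound k hk (fun i => ‖x (f i)‖) (fun i => norm_nonneg _) |l| hl ?_ i
  · exact hxu (norm_eq_zero.1 this)
  intro i
  have h1 := sum_supp G N hadj c k f hinj hs x (f i) (by rw [hs]; exact ⟨i, rfl⟩)
  rw [hx] at h1
  have h2 : |l| * ‖x (f i)‖ = ‖(l • x) (f i)‖ := by simp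
  rw [h2, h1]
  refine (norm_sum_le _ _).trans (Finset.sum_le_sum fun j _ => ?_)
  rw [norm_mul]
  split_ifs with hij
  · rw [norm_of_pow_six (ent_pow_six (hent _ _) ((hadj _ _).1 ((hpa i j).2 hij))), one_mul]
  · have : N (f i) (f j) = 0 := by
      by_contra h0
      exact hij ((hpa i j).1 ((hadj _ _).2 h0))
    simp [this]


lemma backward_cycle (hdiag : ∀ u, N u u = 0) (c : G.ConnectedComponent) (v₁ v₂ v₃ v₄ : V)
    (h12 : v₁ ≠ v₂) (h13 : v₁ ≠ v₃) (h14 : v₁ ≠ v₄) (h23 : v₂ ≠ v₃) (h24 : v₂ ≠ v₄) (h34 : v₃ ≠ v₄)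
    (hs : c.supp = {v₁, v₂, v₃, v₄})
    (n12 : N v₁ v₂ ≠ 0) (n23 : N v₂ v₃ ≠ 0) (n34 : N v₃ v₄ ≠ 0) (n41 : N v₄ v₁ ≠ 0)
    (n13 : N v₁ v₃ = 0) (n24 : N v₂ v₄ = 0)
    (hw : N v₁ v₂ * N v₂ v₃ * N v₃ v₄ * N v₄ v₁ = -1) (x : V → ℂ) (l : ℝ)
    (hx : N *ᵥ x = l • x) (u : V) (hu : u ∈ c.supp) (hxu : x u ≠ 0) : |l| < Real.sqrt 3 := by
  have n31 : N v₃ v₁ = 0 := by rw [← hherm.apply, n13]; simp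
  have n42 : N v₄ v₂ = 0 := by rw [← hherm.apply, n24]; simp
  have hinj : Function.Injective ![v₁, v₂, v₃, v₄] := by
    intro i j
    fin_cases i <;> fin_cases j <;>
      simp [h12, h13, h14, h23, h24, h34, h12.symm, h13.symm, h14.symm, h23.symm, h24.symm, h34.symm]
  have hs' : c.supp = Set.range ![v₁, v₂, v₃, v₄] := by
    rw [hs]; ext w; simp [eq_comm]; tauto
  have E := sum_supp G N hadj c 4 ![v₁, v₂, v₃, v₄] hinj hs' x
  rw [hx] at E
  have E1 := E v₁ (by simp [hs])
  have E2 := E v₂ (by simp [hs])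
  have E3 := E v₃ (by simp [hs])
  have E4 := E v₄ (by simp [hs])
  simp [Fin.sum_univ_succ, hdiag, n13, n24, n31, n42] at E1 E2 E3 E4
  have a1 := mul_swap N hherm hent _ _ n12
  have a2 := mul_swap N hherm hent _ _ n23
  have a3 := mul_swap N hherm hent _ _ n34
  have a4 := mul_swap N hherm hent _ _ n41
  have key : (l : ℂ) ^ 2 * x u = 2 * x u := by
    rw [hs] at hu
    simp only [Set.mem_insert_iff, Set.mem_singleton_iff] at hu
    rcases hu with rfl | rfl | rfl | rfl
    · exact cycle_alg (b := N v₂ v₃) (y2 := x v₂) (y3 := x v₃) (y4 := x v₄)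
        a1 a3 a4 hw (by linear_combination E1) (by linear_combination E2)
        (by linear_combination E4)
    · exact cycle_alg (b := N v₃ v₄) (y2 := x v₃) (y3 := x v₄) (y4 := x v₁)
        a2 a4 a1 (by linear_combination hw) (by linear_combination E2)
        (by linear_combination E3) (by linear_combination E1)
    · exact cycle_alg (b := N v₄ v₁) (y2 := x v₄) (y3 := x v₁) (y4 := x v₂)
        a3 a1 a2 (by linear_combination hw) (by linear_combination E3)
        (by linear_combination E4) (by linear_combination E2)
    · exact cycle_alg (b := N v₁ v₂) (y2 := x v₁) (y3 := x v₂) (y4 := x v₃)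
        a4 a2 a3 (by linear_combination hw) (by linear_combination E4)
        (by linear_combination E1) (by linear_combination E3)
  have h2 : (l : ℂ) ^ 2 = 2 := mul_right_cancel₀ hxu key
  have h3 : l ^ 2 = 2 := by exact_mod_cast h2
  apply Real.lt_sqrt_of_sq_lt
  rw [sq_abs]; linarith

lemma forward (hdiag : ∀ u, N u u = 0)
    (CN : ∀ u a b x : V, a ≠ b → N u a ≠ 0 → N u b ≠ 0 → N u x ≠ 0 → x = a ∨ x = b)
    (CC : ∀ u w a b d : V, u ≠ w → a ≠ b → a ≠ d → N u a ≠ 0 → N u b ≠ 0 → N w a ≠ 0 →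
      N w d ≠ 0 → b = d ∧ N u a * N a w + N u b * N b w = 0)
    (c : G.ConnectedComponent) :
        (∃ k : ℕ, 1 ≤ k ∧ k ≤ 4 ∧
          Nonempty ((G.induce c.supp) ≃g SimpleGraph.pathGraph k)) ∨
        (∃ v₁ v₂ v₃ v₄ : V, v₁ ≠ v₂ ∧ v₁ ≠ v₃ ∧ v₁ ≠ v₄ ∧ v₂ ≠ v₃ ∧ v₂ ≠ v₄ ∧ v₃ ≠ v₄ ∧
          c.supp = {v₁, v₂, v₃, v₄} ∧
          N v₁ v₂ ≠ 0 ∧ N v₂ v₃ ≠ 0 ∧ N v₃ v₄ ≠ 0 ∧ N v₄ v₁ ≠ 0 ∧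
          N v₁ v₃ = 0 ∧ N v₂ v₄ = 0 ∧
          N v₁ v₂ * N v₂ v₃ * N v₃ v₄ * N v₄ v₁ = -1) := by
  have sw : ∀ u v, N u v ≠ 0 → N v u ≠ 0 := ne_swap N hherm hent
  have ms := mul_swap N hherm hent
  have ne : ∀ u v, N u v ≠ 0 → u ≠ v := by
    rintro u v h rfl
    exact h (hdiag u)
  have adjc : ∀ u w, u ∈ c.supp → N u w ≠ 0 → w ∈ c.supp := fun u w hu h =>
    (SimpleGraph.ConnectedComponent.mem_supp_congr_adj c ((hadj u w).2 h)).1 hu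
  -- the path on four vertices
  have P4 : ∀ b m a z, m ∈ c.supp → a ≠ b → N m a ≠ 0 → N m b ≠ 0 → N a z ≠ 0 → z ≠ m →
      (∀ w, N b w ≠ 0 → w = m) → Nonempty ((G.induce c.supp) ≃g SimpleGraph.pathGraph 4) := by
    intro b m a z hm hab ha hb hz hzm hbw
    have ham := sw _ _ ha
    have hbm := sw _ _ hb
    have hza := sw _ _ hz
    have hzb : z ≠ b := by
      rintro rfl
      exact (ne _ _ ha).symm (hbw a hza)
    have nba : N b a = 0 := by
      by_contra h; exact (ne _ _ ha).symm (hbw a h)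
    have nab : N a b = 0 := by
      by_contra h; exact sw _ _ h nba
    have nbz : N b z = 0 := by
      by_contra h; exact hzm (hbw z h)
    have nzb : N z b = 0 := by
      by_contra h; exact sw _ _ h nbz
    have nmz : N m z = 0 := by
      by_contra h
      rcases CN m a b z hab ha hb h with h1 | h1
      · exact ne _ _ hz h1.symm
      · exact hzb h1
    have nzm : N z m = 0 := by
      by_contra h; exact sw _ _ h nmz
    have hzw : ∀ w, N z w ≠ 0 → w = a := by
      intro w hw
      by_contra hwa
      have := (CC m z a b w hzm.symm hab (Ne.symm hwa) ha hb hza hw).1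
      subst this
      exact hw nzb
    refine comp_path G c 4 ![b, m, a, z] ?_ ?_ ?_ 1 (by simpa using hm)
    · have q1 := ne _ _ ha
      have q2 := ne _ _ hb
      have q3 := ne _ _ hz
      intro i j
      fin_cases i <;> fin_cases j <;>
        simp [q1, q2, q3, hab, hzm, hzb, q1.symm, q2.symm, q3.symm, hab.symm, hzm.symm, hzb.symm]
    · intro i j
      rw [hadj, SimpleGraph.pathGraph_adj]
      fin_cases i <;> fin_cases j <;> simp [hdiag, *]
    · intro i w hw
      rw [hadj] at hw
      fin_cases i
      · exact ⟨1, (hbw w hw).symm⟩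
      · rcases CN m a b w hab ha hb hw with h | h
        · exact ⟨2, h.symm⟩
        · exact ⟨0, h.symm⟩
      · rcases CN a m z w hzm.symm ham hz hw with h | h
        · exact ⟨1, h.symm⟩
        · exact ⟨3, h.symm⟩
      · exact ⟨2, (hzw w hw).symm⟩
  by_cases H : ∃ m ∈ c.supp, ∃ a b, a ≠ b ∧ N m a ≠ 0 ∧ N m b ≠ 0
  · obtain ⟨m, hm, a, b, hab, ha, hb⟩ := H
    have ham := sw _ _ ha
    have hbm := sw _ _ hb
    have q1 := ne _ _ ha
    have q2 := ne _ _ hb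
    have nab : N a b = 0 := by
      by_contra h
      exact hab (CC a b m b a hab q2 q1 ham h hbm (sw _ _ h)).1.symm
    have nba : N b a = 0 := by
      by_contra h; exact sw _ _ h nab
    by_cases hA : ∃ z, N a z ≠ 0 ∧ z ≠ m
    · obtain ⟨z, hz, hzm⟩ := hA
      by_cases hB : ∃ y, N b y ≠ 0 ∧ y ≠ m
      · right
        obtain ⟨y, hy, hym⟩ := hB
        obtain ⟨rfl, hsum⟩ := CC a b m z y hab hzm.symm hym.symm ham hz hbm hy
        have hza := sw _ _ hz
        have hzb := sw _ _ hy
        have nmz : N m z = 0 := by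
          by_contra h
          rcases CN m a b z hab ha hb h with rfl | rfl
          · exact hz (hdiag _)
          · exact hy (hdiag _)
        refine ⟨m, a, z, b, q1, hzm.symm, q2, ne _ _ hz, hab, ne _ _ hzb, ?_, ha, hz, hzb, hbm,
          nmz, nab, ?_⟩
        · have r : ∀ u v, N u v ≠ 0 → G.Reachable u v := fun u v h => ((hadj u v).2 h).reachable
          refine supp_eq G c _ ?_ m (by simp) hm ?_
          · intro u hu w hw
            rw [hadj] at hw
            simp only [Set.mem_insert_iff, Set.mem_singleton_iff] at hu ⊢
            rcases hu with rfl | rfl | rfl | rfl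
            · rcases CN _ _ _ w hab ha hb hw with h | h <;> simp [h]
            · rcases CN _ _ _ w hzm.symm ham hz hw with h | h <;> simp [h]
            · rcases CN _ _ _ w hab hza hzb hw with h | h <;> simp [h]
            · rcases CN _ _ _ w hzm.symm hbm hy hw with h | h <;> simp [h]
          · intro w hw
            simp only [Set.mem_insert_iff, Set.mem_singleton_iff] at hw
            rcases hw with rfl | rfl | rfl | rfl
            · rfl
            · exact r _ _ ha
            · exact (r _ _ ha).trans (r _ _ hz)
            · exact r _ _ hb
        · have m1 := ms _ _ ha
          have m2 := ms _ _ hb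
          linear_combination N m a * N b m * hsum - N m b * N b m * m1 - m2
      · left
        push Not at hB
        exact ⟨4, by norm_num, by norm_num, P4 b m a z hm hab ha hb hz hzm hB⟩
    · left
      push Not at hA
      by_cases hB : ∃ y, N b y ≠ 0 ∧ y ≠ m
      · obtain ⟨y, hy, hym⟩ := hB
        exact ⟨4, by norm_num, by norm_num, P4 a m b y hm hab.symm hb ha hy hym hA⟩
      · push Not at hB
        refine ⟨3, by norm_num, by norm_num,
          comp_path G c 3 ![a, m, b] ?_ ?_ ?_ 1 (by simpa using hm)⟩
        · intro i j
          fin_cases i <;> fin_cases j <;>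
            simp [q1, q2, hab, q1.symm, q2.symm, hab.symm]
        · intro i j
          rw [hadj, SimpleGraph.pathGraph_adj]
          fin_cases i <;> fin_cases j <;> simp [hdiag, ha, hb, ham, hbm, nab, nba]
        · intro i w hw
          rw [hadj] at hw
          fin_cases i
          · exact ⟨1, (hA w hw).symm⟩
          · rcases CN m a b w hab ha hb hw with h | h
            · exact ⟨0, h.symm⟩
            · exact ⟨2, h.symm⟩
          · exact ⟨1, (hB w hw).symm⟩
  · left
    push Not at H
    obtain ⟨v, hv⟩ := c.nonempty_supp
    by_cases H2 : ∃ a, N v a ≠ 0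
    · obtain ⟨a, ha⟩ := H2
      have hav := sw _ _ ha
      have q := ne _ _ ha
      refine ⟨2, by norm_num, by norm_num,
        comp_path G c 2 ![v, a] ?_ ?_ ?_ 0 (by simpa using hv)⟩
      · intro i j
        fin_cases i <;> fin_cases j <;> simp [q, q.symm]
      · intro i j
        rw [hadj, SimpleGraph.pathGraph_adj]
        fin_cases i <;> fin_cases j <;> simp [hdiag, ha, hav]
      · intro i w hw
        rw [hadj] at hw
        fin_cases i
        · refine ⟨1, ?_⟩
          by_contra h
          exact hw (H v hv a w h ha)
        · refine ⟨0, ?_⟩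
          by_contra h
          exact hw (H a (adjc v a hv ha) v w h hav)
    · push Not at H2
      refine ⟨1, by norm_num, by norm_num,
        comp_path G c 1 ![v] ?_ ?_ ?_ 0 (by simpa using hv)⟩
      · exact Function.injective_of_subsingleton _
      · intro i j
        fin_cases i; fin_cases j
        simp
      · intro i w hw
        rw [hadj] at hw
        fin_cases i
        exact absurd (H2 w) hw

end

/-- Every eigenvalue of the N-matrix of a mixed graph has absolute value
`< √3` iff every connected component of the underlying graph is either a path on at most `4`
vertices or a quadrangle whose weight is `−1`. -/
theorem spectral_radius_lt_sqrt_three_iff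
    {V : Type*} [Fintype V] [DecidableEq V]
    (N : Matrix V V ℂ) (hherm : N.IsHermitian)
    (hdiag : ∀ u, N u u = 0)
    (hent : ∀ u v, N u v ∈ ({0, 1, ω6, star ω6} : Set ℂ))
    (G : SimpleGraph V) (hadj : ∀ u v, G.Adj u v ↔ N u v ≠ 0) :
    (∀ i, |hherm.eigenvalues i| < Real.sqrt 3) ↔
      ∀ c : G.ConnectedComponent,
        (∃ k : ℕ, 1 ≤ k ∧ k ≤ 4 ∧
          Nonempty ((G.induce c.supp) ≃g SimpleGraph.pathGraph k)) ∨
        (∃ v₁ v₂ v₃ v₄ : V, v₁ ≠ v₂ ∧ v₁ ≠ v₃ ∧ v₁ ≠ v₄ ∧ v₂ ≠ v₃ ∧ v₂ ≠ v₄ ∧ v₃ ≠ v₄ ∧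
          c.supp = {v₁, v₂, v₃, v₄} ∧
          N v₁ v₂ ≠ 0 ∧ N v₂ v₃ ≠ 0 ∧ N v₃ v₄ ≠ 0 ∧ N v₄ v₁ ≠ 0 ∧
          N v₁ v₃ = 0 ∧ N v₂ v₄ = 0 ∧
          N v₁ v₂ * N v₂ v₃ * N v₃ v₄ * N v₄ v₁ = -1) := by
  constructor
  · intro h
    have hP := posDef_three_sub N hherm h
    exact forward N hherm hent G hadj hdiag (nbr_cases N hherm hent hP) (common_nbr N hherm hent hP)
  · intro h i
    have hx := hherm.mulVec_eigenvectorBasis i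
    obtain ⟨u, hu⟩ : ∃ u, (hherm.eigenvectorBasis i) u ≠ 0 := by
      by_contra hcon
      push Not at hcon
      apply hherm.eigenvectorBasis.orthonormal.ne_zero i
      ext u
      exact hcon u
    have hmem : u ∈ (G.connectedComponentMk u).supp := by simp
    rcases h (G.connectedComponentMk u) with ⟨k, _, hk, ⟨e⟩⟩ |
      ⟨v₁, v₂, v₃, v₄, h12, h13, h14, h23, h24, h34, hs, n12, n23, n34, n41, n13, n24, hw⟩
    · exact backward_path N hherm hent G hadj _ k hk e _ _ hx u hmem hu
    · exact backward_cycle N hherm hent G hadj hdiag _ v₁ v₂ v₃ v₄ h12 h13 h14 h23 h24 h34 hs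
        n12 n23 n34 n41 n13 n24 hw _ _ hx u hmem hu
end

section
/- Let n ≥ 3 and let N be the N-matrix of a mixed cycle on vertex set ZMod n (N_{i,j} ≠ 0 iff j = i ± 1 mod n), with weight w = ∏_{i ∈ ZMod n} N_{i,i+1}. If w ∈ {ω, ω̄, −ω, −ω̄} (the cycle is semi-positive or semi-negative), or if w = −1 and n is even (an even negative cycle), then every eigenvalue λ of N satisfies |λ| < 2. -/
open Matrix Complex

theorem semi_aux
    (n : ℕ) (hn : 3 ≤ n) [NeZero n]
    (N : Matrix (ZMod n) (ZMod n) ℂ) (hherm : N.IsHermitian)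
    (hent : ∀ u v, N u v ∈ ({0, 1, ω6, star ω6} : Set ℂ))
    (hcyc : ∀ i j : ZMod n, N i j ≠ 0 ↔ (j = i + 1 ∨ j = i - 1))
    (l s : ℝ) (hs : s = 1 ∨ s = -1) (hl : 2 ≤ s * l) (x : ZMod n → ℂ) (hx : x ≠ 0)
    (hev : N *ᵥ x = (l : ℂ) • x) :
    (∏ i : ZMod n, N i (i + 1)) = (s : ℂ) ^ n := by
  have hs2 : s * s = 1 := by rcases hs with h | h <;> rw [h] <;> norm_num
  have h3 : Real.sqrt 3 * Real.sqrt 3 = 3 := Real.mul_self_sqrt (by norm_num)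
  have hne : ∀ i : ZMod n, i + 1 ≠ i - 1 := by
    intro i h
    have h2 : ((2 : ℕ) : ZMod n) = 0 := by
      push_cast
      linear_combination h
    rw [ZMod.natCast_eq_zero_iff] at h2
    have := Nat.le_of_dvd (by norm_num) h2
    omega
  have hnorm : ∀ i : ZMod n, normSq (N i (i + 1)) = 1 := by
    intro i
    have h0 : N i (i + 1) ≠ 0 := (hcyc i (i + 1)).2 (Or.inl rfl)
    have hw : normSq ω6 = 1 := by
      simp [ω6, normSq_apply]
      nlinarith
    have hm := hent i (i + 1)
    simp only [Set.mem_insert_iff, Set.mem_singleton_iff] at hm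
    rcases hm with h | h | h | h
    · exact absurd h h0
    · rw [h]; simp
    · rw [h, hw]
    · rw [h]
      simpa [normSq_conj] using hw
  have hrow : ∀ i : ZMod n,
      N i (i + 1) * x (i + 1) + N i (i - 1) * x (i - 1) = (l : ℂ) * x i := by
    intro i
    have h := congrFun hev i
    simp only [mulVec, dotProduct, Pi.smul_apply, smul_eq_mul] at h
    rw [← h, ← Finset.sum_pair (f := fun j => N i j * x j) (hne i)]
    apply Finset.sum_subset (Finset.subset_univ _)
    intro j _ hj
    have : N i j = 0 := by
      by_contra hc
      have := (hcyc i j).1 hc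
      simp at hj
      tauto
    rw [this, zero_mul]
  have hre : ∀ i : ZMod n, l * normSq (x i) =
      (star (x i) * (N i (i + 1) * x (i + 1))).re
      + (star (x (i - 1)) * (N (i - 1) (i - 1 + 1) * x (i - 1 + 1))).re := by
    intro i
    have h := congrArg (fun z => (star (x i) * z).re) (hrow i)
    have hh : N i (i - 1) = star (N (i - 1) i) := (hherm.apply i (i - 1)).symm
    simp only [hh] at h
    rw [sub_add_cancel]
    simp [normSq_apply] at h ⊢
    linarith
  have hshift : ∀ f : ZMod n → ℝ, ∑ i, f (i + 1) = ∑ i, f i := fun f =>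
    Equiv.sum_comp (Equiv.addRight (1 : ZMod n)) f
  have hshift' : ∀ f : ZMod n → ℝ, ∑ i, f (i - 1) = ∑ i, f i := fun f =>
    Equiv.sum_comp (Equiv.subRight (1 : ZMod n)) f
  have hsum : l * ∑ i, normSq (x i) =
      2 * ∑ i, (star (x i) * (N i (i + 1) * x (i + 1))).re := by
    rw [Finset.mul_sum, Finset.sum_congr rfl (fun i _ => hre i), Finset.sum_add_distrib,
      hshift' (fun i => (star (x i) * (N i (i + 1) * x (i + 1))).re)]
    ring
  have hexp : ∀ i : ZMod n, normSq (N i (i + 1) * x (i + 1) - s * x i) =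
      normSq (x (i + 1)) + normSq (x i)
        - 2 * s * (star (x i) * (N i (i + 1) * x (i + 1))).re := by
    intro i
    rw [normSq_sub, normSq_mul, normSq_mul, hnorm, normSq_ofReal, hs2]
    simp
    ring
  have hS0 : 0 ≤ ∑ i, normSq (x i) := Finset.sum_nonneg fun i _ => normSq_nonneg _
  have hle : ∑ i, normSq (N i (i + 1) * x (i + 1) - s * x i) ≤ 0 := by
    rw [Finset.sum_congr rfl (fun i _ => hexp i), Finset.sum_sub_distrib,
      Finset.sum_add_distrib, hshift (fun i => normSq (x i)), ← Finset.mul_sum]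
    have h1 := mul_le_mul_of_nonneg_right hl hS0
    have h2 : s * (l * ∑ i, normSq (x i)) = s * (2 * _) := congrArg (fun z => s * z) hsum
    linarith
  have hz : ∀ i : ZMod n, N i (i + 1) * x (i + 1) = s * x i := by
    intro i
    have h := (Finset.sum_eq_zero_iff_of_nonneg (fun i _ => normSq_nonneg _)).1
      (le_antisymm hle (Finset.sum_nonneg fun i _ => normSq_nonneg _)) i (Finset.mem_univ i)
    exact sub_eq_zero.1 (normSq_eq_zero.1 h)
  have hsne : (s : ℂ) ≠ 0 := by
    rcases hs with h | h <;> rw [h] <;> norm_num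
  have hstep : ∀ i : ZMod n, x i ≠ 0 → x (i + 1) ≠ 0 := by
    intro i hi h0
    have h := hz i
    rw [h0, mul_zero] at h
    exact mul_ne_zero hsne hi h.symm
  obtain ⟨j, hj⟩ := Function.ne_iff.1 hx
  have hall : ∀ k : ℕ, x (j + k) ≠ 0 := by
    intro k
    induction k with
    | zero => simpa using hj
    | succ k ih =>
      have := hstep _ ih
      push_cast
      rwa [← add_assoc]
  have hall' : ∀ i, x i ≠ 0 := by
    intro i
    have h := hall (i - j).val
    rwa [ZMod.natCast_zmod_val, add_sub_cancel] at h
  have hprod : (∏ i : ZMod n, N i (i + 1)) * ∏ i, x i = (s : ℂ) ^ n * ∏ i, x i := by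
    have h1 : ∏ i, x (i + 1) = ∏ i, x i := Equiv.prod_comp (Equiv.addRight (1 : ZMod n)) x
    conv_lhs => rw [← h1]
    rw [← Finset.prod_mul_distrib, Finset.prod_congr rfl (fun i _ => hz i),
      Finset.prod_mul_distrib]
    simp [ZMod.card]
  exact mul_right_cancel₀ (Finset.prod_ne_zero_iff.2 fun i _ => hall' i) hprod

/-- If a mixed cycle on `n ≥ 3` vertices is semi-positive or semi-negative
(weight in `{ω, ω̄, −ω, −ω̄}`), or is negative of even order, then every eigenvalue `λ` of its
N-matrix satisfies `|λ| < 2`. -/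
theorem semipos_semineg_even_neg_cycle_spectral_radius_lt_two
    (n : ℕ) (hn : 3 ≤ n) [NeZero n]
    (N : Matrix (ZMod n) (ZMod n) ℂ) (hherm : N.IsHermitian)
    (hdiag : ∀ u, N u u = 0)
    (hent : ∀ u v, N u v ∈ ({0, 1, ω6, star ω6} : Set ℂ))
    (hcyc : ∀ i j : ZMod n, N i j ≠ 0 ↔ (j = i + 1 ∨ j = i - 1))
    (hwt : (∏ i : ZMod n, N i (i + 1)) ∈ ({ω6, star ω6, -ω6, -star ω6} : Set ℂ) ∨
      ((∏ i : ZMod n, N i (i + 1)) = -1 ∧ Even n)) :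
    ∀ i, |hherm.eigenvalues i| < 2 := by
  intro i
  by_contra hcon
  rw [not_lt] at hcon
  obtain ⟨s, hs, hl⟩ : ∃ s : ℝ, (s = 1 ∨ s = -1) ∧ 2 ≤ s * hherm.eigenvalues i := by
    rcases le_abs.1 hcon with h | h
    · exact ⟨1, Or.inl rfl, by linarith⟩
    · exact ⟨-1, Or.inr rfl, by linarith⟩
  have hx : (hherm.eigenvectorBasis i).ofLp ≠ 0 := by
    intro h
    apply hherm.eigenvectorBasis.orthonormal.ne_zero i
    ext j
    exact congrFun h j
  have hw := semi_aux n hn N hherm hent hcyc _ s hs hl _ hx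
    (by
      rw [hherm.mulVec_eigenvectorBasis i]
      ext j
      simp)
  rw [hw] at hwt
  have h3 : Real.sqrt 3 ≠ 0 := by positivity
  rcases hwt with h | ⟨h, he⟩
  · have hne : ω6.im ≠ 0 := by simp [ω6]
    have him : ((s : ℂ) ^ n).im = 0 := by rw [← ofReal_pow, ofReal_im]
    simp only [Set.mem_insert_iff, Set.mem_singleton_iff] at h
    rcases h with h | h | h | h <;> rw [h] at him <;> apply hne <;> simpa using him
  · have : (s : ℂ) ^ n = 1 := by
      rcases hs with h | h <;> rw [h] <;> simp [he]
    rw [this] at h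
    norm_num at h
end

section
/- Let N be the N-matrix of a mixed graph on a finite vertex set V such that every eigenvalue λ of N satisfies |λ| < 2. Then for any four distinct vertices v₁, v₂, v₃, v₄ forming a quadrangle in the underlying graph (N_{v₁v₂}, N_{v₂v₃}, N_{v₃v₄}, N_{v₄v₁} all nonzero): (i) the quadrangle is chordless, i.e., N_{v₁v₃} = 0 and N_{v₂v₄} = 0; and (ii) the quadrangle is not positive, i.e., N_{v₁v₂}·N_{v₂v₃}·N_{v₃v₄}·N_{v₄v₁} ≠ 1. -/
open Matrix Complex

section Aux

open scoped ComplexOrder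

lemma six_of_mem {x : ℂ} (hx : x ∈ ({0, 1, ω6, star ω6} : Set ℂ)) (h0 : x ≠ 0) :
    x ^ 6 = 1 ∧ x * star x = 1 := by
  have h3 : ((Real.sqrt 3 : ℝ) : ℂ) ^ 2 = 3 := by
    rw [← Complex.ofReal_pow, Real.sq_sqrt (by norm_num)]; norm_num
  have hstar : star ω6 = (1 - Complex.I * Real.sqrt 3) / 2 := by
    simp [ω6, sub_eq_add_neg]
  have hmul : ω6 * star ω6 = 1 := by
    rw [hstar, ω6]
    linear_combination (-Complex.I ^ 2 / 4) * h3 - 3 / 4 * Complex.I_sq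
  have hadd : ω6 + star ω6 = 1 := by
    rw [hstar, ω6]; ring
  generalize hy : star ω6 = y at *
  generalize hz : ω6 = z at *
  have hq : z ^ 2 - z + 1 = 0 := by linear_combination z * hadd - hmul
  have hq' : y ^ 2 - y + 1 = 0 := by linear_combination y * hadd - hmul
  rcases hx with h | h | h | h
  · exact absurd h h0
  · subst h; simp
  · rw [h]
    refine ⟨?_, ?_⟩
    · linear_combination (z ^ 4 + z ^ 3 - z - 1) * hq
    · rw [hy]; exact hmul
  · rw [Set.mem_singleton_iff] at h
    rw [h]
    refine ⟨?_, ?_⟩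
    · linear_combination (y ^ 4 + y ^ 3 - y - 1) * hq'
    · rw [← hy, star_star, hy, mul_comm]; exact hmul

lemma re_ge_of_six {q : ℂ} (h : q ^ 6 = 1) : -1 ≤ q.re := by
  have hn : ‖q‖ = 1 := Complex.norm_eq_one_of_pow_eq_one h (by norm_num)
  have := Complex.abs_re_le_norm q
  rw [hn] at this
  exact (abs_le.mp this).1

lemma eq_neg_one_of_six {q : ℂ} (h : q ^ 6 = 1) (hr : q.re < -1 / 2) : q = -1 := by
  have hf : (q - 1) * ((q + 1) * ((q ^ 2 + q + 1) * (q ^ 2 - q + 1))) = 0 := by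
    linear_combination h
  rcases mul_eq_zero.mp hf with h1 | h1
  · have : q = 1 := by linear_combination h1
    rw [this] at hr; norm_num at hr
  rcases mul_eq_zero.mp h1 with h1 | h1
  · linear_combination h1
  exfalso
  rcases mul_eq_zero.mp h1 with h1 | h1
  all_goals
    have e1 := congrArg Complex.re h1
    have e2 := congrArg Complex.im h1
    simp [pow_two] at e1 e2
  · have : q.im * (2 * q.re + 1) = 0 := by linarith
    rcases mul_eq_zero.mp this with h2 | h2
    · rw [h2] at e1; nlinarith [sq_nonneg (q.re + 1 / 2)]
    · linarith
  · have : q.im * (2 * q.re - 1) = 0 := by linarith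
    rcases mul_eq_zero.mp this with h2 | h2
    · rw [h2] at e1; nlinarith [sq_nonneg (q.re - 1 / 2)]
    · linarith

lemma posDef_two {V : Type*} [Fintype V] [DecidableEq V]
    (N : Matrix V V ℂ) (hherm : N.IsHermitian)
    (hspec : ∀ i, |hherm.eigenvalues i| < 2) (s : ℝ) (hs : |s| = 1) :
    ((2 : ℂ) • (1 : Matrix V V ℂ) + (s : ℂ) • N).PosDef := by
  have hsp := hherm.spectral_theorem
  set U := hherm.eigenvectorUnitary
  have hD : (Matrix.diagonal (fun i => ((2 + s * hherm.eigenvalues i : ℝ) : ℂ))).PosDef := by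
    refine Matrix.PosDef.diagonal fun i => ?_
    have h1 := hspec i
    have h2 : |s * hherm.eigenvalues i| < 2 := by rw [abs_mul, hs, one_mul]; exact h1
    have := (abs_lt.mp h2).1
    exact_mod_cast (by linarith : (0:ℝ) < 2 + s * hherm.eigenvalues i)
  have key : (2 : ℂ) • (1 : Matrix V V ℂ) + (s : ℂ) • N =
      (U : Matrix V V ℂ) * Matrix.diagonal (fun i => ((2 + s * hherm.eigenvalues i : ℝ) : ℂ)) *
        (U : Matrix V V ℂ)ᴴ := by
    have hd : Matrix.diagonal (fun i => ((2 + s * hherm.eigenvalues i : ℝ) : ℂ)) =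
        (2 : ℂ) • (1 : Matrix V V ℂ) +
          (s : ℂ) • Matrix.diagonal (RCLike.ofReal ∘ hherm.eigenvalues) := by
      ext i j
      by_cases hij : i = j
      · subst hij; simp
      · simp [hij]
    have hU : (U : Matrix V V ℂ) * (U : Matrix V V ℂ)ᴴ = 1 := Unitary.coe_mul_star_self U
    rw [hd, mul_add, add_mul]
    congr 1
    · simp [hU]
    · conv_lhs => rw [hsp]
      simp [Unitary.conjStarAlgAut_apply, Matrix.star_eq_conjTranspose]
  rw [key]
  refine hD.mul_mul_conjTranspose_same ?_
  refine Matrix.vecMul_injective_of_isUnit ?_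
  exact (Unitary.toUnits U).isUnit

lemma det_pos_four {V : Type*} [Fintype V] [DecidableEq V]
    (N : Matrix V V ℂ) (hherm : N.IsHermitian)
    (hspec : ∀ i, |hherm.eigenvalues i| < 2) (s : ℝ) (hs : |s| = 1)
    (f : Fin 4 → V) (hf : Function.Injective f) :
    0 < ((2 : ℂ) • (1 : Matrix (Fin 4) (Fin 4) ℂ) + (s : ℂ) • N.submatrix f f).det := by
  have h := ((posDef_two N hherm hspec s hs).submatrix hf).det_pos
  have e : (2 : ℂ) • (1 : Matrix (Fin 4) (Fin 4) ℂ) + (s : ℂ) • N.submatrix f f =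
      ((2 : ℂ) • (1 : Matrix V V ℂ) + (s : ℂ) • N).submatrix f f := by
    ext i j
    simp [Matrix.one_apply, hf.eq_iff]
  rw [e]
  exact h

lemma det_sum (A : Matrix (Fin 4) (Fin 4) ℂ) (h : ∀ i, A i i = 0) :
    ((2 : ℂ) • (1 : Matrix (Fin 4) (Fin 4) ℂ) + ((1 : ℝ) : ℂ) • A).det +
    ((2 : ℂ) • (1 : Matrix (Fin 4) (Fin 4) ℂ) + ((-1 : ℝ) : ℂ) • A).det =
    2 * (16 - 4 * (A 0 1 * A 1 0 + A 0 2 * A 2 0 + A 0 3 * A 3 0 + A 1 2 * A 2 1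
      + A 1 3 * A 3 1 + A 2 3 * A 3 2)
      + (A 0 1 * A 1 0) * (A 2 3 * A 3 2) + (A 0 2 * A 2 0) * (A 1 3 * A 3 1)
      + (A 0 3 * A 3 0) * (A 1 2 * A 2 1)
      - (A 0 1 * A 1 2 * A 2 3 * A 3 0 + A 1 0 * A 2 1 * A 3 2 * A 0 3)
      - (A 0 1 * A 1 3 * A 3 2 * A 2 0 + A 1 0 * A 3 1 * A 2 3 * A 0 2)
      - (A 0 2 * A 2 1 * A 1 3 * A 3 0 + A 2 0 * A 1 2 * A 3 1 * A 0 3)) := by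
  simp [Matrix.det_succ_row_zero, Fin.sum_univ_succ, Matrix.one_apply, h, Fin.succAbove]
  ring

lemma quadrangle_aux
    {V : Type*} [Fintype V] [DecidableEq V]
    (N : Matrix V V ℂ) (hherm : N.IsHermitian)
    (hdiag : ∀ u, N u u = 0)
    (hent : ∀ u v, N u v ∈ ({0, 1, ω6, star ω6} : Set ℂ))
    (hspec : ∀ i, |hherm.eigenvalues i| < 2) :
    ∀ v₁ v₂ v₃ v₄ : V, v₁ ≠ v₂ → v₁ ≠ v₃ → v₁ ≠ v₄ → v₂ ≠ v₃ → v₂ ≠ v₄ → v₃ ≠ v₄ →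
      N v₁ v₂ ≠ 0 → N v₂ v₃ ≠ 0 → N v₃ v₄ ≠ 0 → N v₄ v₁ ≠ 0 →
      (N v₁ v₃ = 0 ∧ N v₂ v₄ = 0) ∧
      N v₁ v₂ * N v₂ v₃ * N v₃ v₄ * N v₄ v₁ ≠ 1 := by
  intro v₁ v₂ v₃ v₄ h12 h13 h14 h23 h24 h34 n12 n23 n34 n41
  have hf : Function.Injective ![v₁, v₂, v₃, v₄] := by
    intro i j hij
    fin_cases i <;> fin_cases j <;> simp_all [eq_comm]
  have p1 := det_pos_four N hherm hspec 1 (by simp) _ hf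
  have p2 := det_pos_four N hherm hspec (-1) (by simp) _ hf
  have p := add_pos p1 p2
  rw [det_sum _ (by intro i; simp [hdiag])] at p
  have hS : ∀ u v, N v u = star (N u v) := fun u v => (hherm.apply v u).symm
  simp only [Matrix.submatrix_apply, Matrix.cons_val] at p
  obtain ⟨s12, u12⟩ := six_of_mem (hent _ _) n12
  obtain ⟨s23, u23⟩ := six_of_mem (hent _ _) n23
  obtain ⟨s34, u34⟩ := six_of_mem (hent _ _) n34
  obtain ⟨s41, u41⟩ := six_of_mem (hent _ _) n41
  have s13 := fun h => six_of_mem (hent v₁ v₃) h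
  have s24 := fun h => six_of_mem (hent v₂ v₄) h
  rw [hS v₁ v₂, hS v₂ v₃, hS v₃ v₄, hS v₄ v₁, hS v₁ v₃, hS v₂ v₄] at p
  generalize N v₁ v₂ = a at *
  generalize N v₂ v₃ = b at *
  generalize N v₃ v₄ = c at *
  generalize N v₄ v₁ = d at *
  generalize N v₁ v₃ = e at *
  generalize N v₂ v₄ = g at *
  rw [mul_comm (star d) d, u12, u23, u34, u41] at p
  have cs : ∀ x y z w : ℂ, star x * star y * star z * star w = star (x * y * z * w) := by
    intro x y z w; simp
  have qa : (a * b * c * d) ^ 6 = 1 := by simp only [mul_pow, s12, s23, s34, s41, mul_one]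
  have t1 : a * b * c * d + star a * star b * star c * star d
      = ((2 * (a * b * c * d).re : ℝ) : ℂ) := by
    rw [cs]; exact Complex.add_conj _
  have r1 := re_ge_of_six qa
  rw [t1] at p
  have main : e = 0 ∧ g = 0 := by
    by_cases he : e = 0
    · by_cases hg : g = 0
      · exact ⟨he, hg⟩
      · exfalso
        rw [he, (s24 hg).2] at p
        simp only [star_zero, mul_zero, zero_mul] at p
        have p' := (Complex.lt_def.mp p).1
        simp at p' r1
        linarith
    · exfalso
      by_cases hg : g = 0
      · rw [hg, (s13 he).2] at p
        simp only [star_zero, mul_zero, zero_mul] at p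
        have p' := (Complex.lt_def.mp p).1
        simp at p' r1
        linarith
      · obtain ⟨s13, u13⟩ := s13 he
        obtain ⟨s24, u24⟩ := s24 hg
        have st : ∀ x : ℂ, x ^ 6 = 1 → (star x) ^ 6 = 1 := by
          intro x hx; rw [← star_pow, hx, star_one]
        have qb : (a * g * star c * star e) ^ 6 = 1 := by
          simp only [mul_pow, s12, s24, st c s34, st e s13, mul_one]
        have qc : (e * star b * g * d) ^ 6 = 1 := by
          simp only [mul_pow, s13, s24, st b s23, s41, mul_one]
        have t2 : a * g * star c * star e + star a * star g * c * e
            = ((2 * (a * g * star c * star e).re : ℝ) : ℂ) := by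
          rw [← Complex.add_conj]; simp
        have t3 : e * star b * g * d + star e * b * star g * star d
            = ((2 * (e * star b * g * d).re : ℝ) : ℂ) := by
          rw [← Complex.add_conj]; simp
        rw [t2, t3, u13, u24] at p
        have r2 := re_ge_of_six qb
        have r3 := re_ge_of_six qc
        have k1 := @eq_neg_one_of_six _ qa
        have k2 := @eq_neg_one_of_six _ qb
        have k3 := @eq_neg_one_of_six _ qc
        have p' : 0 < 2 * (16 - 4 * 6 + 3 - 2 * (a * b * c * d).re
            - 2 * (a * g * star c * star e).re - 2 * (e * star b * g * d).re) := by
          have : (0 : ℂ) < ((2 * (16 - 4 * 6 + 3 - 2 * (a * b * c * d).re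
            - 2 * (a * g * star c * star e).re - 2 * (e * star b * g * d).re) : ℝ) : ℂ) := by
            convert p using 1
            push_cast; ring
          exact_mod_cast this
        have k1 := k1 (by linarith)
        have k2 := k2 (by linarith)
        have k3 := k3 (by linarith)
        -- the square of a triangle weight would be `-1`
        have m : (a * b * star e) ^ 2 = -1 := by
          have m1 : (a * b * c * d) * (a * g * star c * star e) = 1 := by
            rw [k1, k2]; norm_num
          have m2 : (a * g * d) * (a * b * star e) = 1 := by
            linear_combination m1 - a * b * d * a * g * star e * u34
          have m3 : a * g * d = - (a * b * star e) := by
            linear_combination (a * b * star e) * k3 - a * g * d * b * star b * u13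
              - a * g * d * u23
          rw [m3] at m2
          linear_combination -m2
        have m6 : (a * b * star e) ^ 6 = 1 := by
          simp only [mul_pow, s12, s23, st e s13, mul_one]
        have : (a * b * star e) ^ 6 = -1 := by
          rw [show 6 = 2 * 3 from rfl, pow_mul, m]; norm_num
        rw [m6] at this
        norm_num at this
  refine ⟨main, fun h => ?_⟩
  obtain ⟨he, hg⟩ := main
  rw [he, hg, h] at p
  simp only [star_zero, mul_zero, zero_mul] at p
  have p' := (Complex.lt_def.mp p).1
  norm_num at p'

end Aux

/-- If every eigenvalue of the N-matrix of a mixed graph has absolute value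
`< 2`, then every quadrangle of the underlying graph is chordless and non-positive. -/
theorem quadrangle_chordless_and_nonpositive
    {V : Type*} [Fintype V] [DecidableEq V]
    (N : Matrix V V ℂ) (hherm : N.IsHermitian)
    (hdiag : ∀ u, N u u = 0)
    (hent : ∀ u v, N u v ∈ ({0, 1, ω6, star ω6} : Set ℂ))
    (hspec : ∀ i, |hherm.eigenvalues i| < 2) :
    ∀ v₁ v₂ v₃ v₄ : V, v₁ ≠ v₂ → v₁ ≠ v₃ → v₁ ≠ v₄ → v₂ ≠ v₃ → v₂ ≠ v₄ → v₃ ≠ v₄ →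
      N v₁ v₂ ≠ 0 → N v₂ v₃ ≠ 0 → N v₃ v₄ ≠ 0 → N v₄ v₁ ≠ 0 →
      (N v₁ v₃ = 0 ∧ N v₂ v₄ = 0) ∧
      N v₁ v₂ * N v₂ v₃ * N v₃ v₄ * N v₄ v₁ ≠ 1 := by
  exact quadrangle_aux N hherm hdiag hent hspec
end
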